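/- There is a bijection between the set M(λ,μ,ν) of 3-dimensional nonnegative integer matrices with 1-marginals λ, μ, ν and the disjoint union over pairs of partitions (α,β) with α ⊵ λ, β ⊵ μ of the sets SSYT(α,λ) × SSYT(β,μ) × LR(α,β;ν), where LR(α,β;ν) is the set of pairs of Littlewood-Richardson multitableaux of shapes α, β, type ν, with equal contents. -/

import Mathlib

open Finset Equiv
open scoped Classical

noncomputable section

/-- Value at `g` of the permutation character of `S_n` induced from the trivial character of
the Young subgroup of the composition `c`: the number of colorings of `Fin n` with fiber
sizes given by `c` that are fixed by `g`. -/
def permChar (n : ℕ) (c : ℕ → ℕ) (g : Perm (Fin n)) : ℚ :=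
  Nat.card {f : Fin n → ℕ // (∀ k, Nat.card {x : Fin n // f x = k} = c k) ∧ ∀ x, f (g x) = f x}

/-- Inner product of class functions (real-valued characters) of `S_n`. -/
def innerChar (n : ℕ) (χ ψ : Perm (Fin n) → ℚ) : ℚ :=
  (∑ g : Perm (Fin n), χ g * ψ g) / (n.factorial : ℚ)

/-- The trivial character `χ^{(n)}` of `S_n`. -/
def trivChar (n : ℕ) : Perm (Fin n) → ℚ := fun _ => 1

/-- The sign character `χ^{(1^n)}` of `S_n`. -/
def signChar (n : ℕ) : Perm (Fin n) → ℚ := fun g => ((Perm.sign g : ℤ) : ℚ)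

/-- Permutation character for an integer vector: zero if some entry is negative. -/
def permCharZ (n : ℕ) (c : ℕ → ℤ) (g : Perm (Fin n)) : ℚ :=
  if ∀ k, 0 ≤ c k then permChar n (fun k => (c k).toNat) g else 0

/-- The irreducible character `χ^a` of `S_n` indexed by the partition `a`, given by the
Jacobi–Trudi determinantal formula `χ^a = ∑_σ sgn(σ) φ^{(a_i - i + σ(i))_i}`. -/
def irrChar (n : ℕ) (a : ℕ → ℕ) (g : Perm (Fin n)) : ℚ :=
  ∑ σ : Perm (Fin n), ((Perm.sign σ : ℤ) : ℚ) *
    permCharZ n (fun i => if h : i < n then (a i : ℤ) - i + ((σ ⟨i, h⟩ : Fin n) : ℕ) else 0) g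

/-- Kronecker coefficient `k(a,b,c) = ⟨χ^a ⊗ χ^b, χ^c⟩`. -/
def kron (n : ℕ) (a b c : ℕ → ℕ) : ℚ :=
  innerChar n (fun g => irrChar n a g * irrChar n b g) (irrChar n c)

/-- Extend a vector indexed by `Fin p` to `ℕ` by zeros. -/
def extc {p : ℕ} (l : Fin p → ℕ) : ℕ → ℕ := fun i => if h : i < p then l ⟨i, h⟩ else 0

/-- Dominance order: `a ⊵ b`. -/
def Dominates (a b : ℕ → ℕ) : Prop :=
  ∀ k, ∑ i ∈ Finset.range k, b i ≤ ∑ i ∈ Finset.range k, a i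

/-- Conjugate (transpose) of a partition with at most `n` parts. -/
def conjFun (n : ℕ) (a : ℕ → ℕ) : ℕ → ℕ :=
  fun j => ((Finset.range n).filter (fun i => j < a i)).card

/-- `a` is a partition of `n` (weakly decreasing, supported on the first `n` parts). -/
def IsPartitionFun (n : ℕ) (a : ℕ → ℕ) : Prop :=
  (∀ i j, i ≤ j → a j ≤ a i) ∧ (∀ i, n ≤ i → a i = 0) ∧ ∑ i ∈ Finset.range n, a i = n

/-- The weakly decreasing sequence of parts of `P : Nat.Partition n`. -/
def pf {n : ℕ} (P : n.Partition) : ℕ → ℕ :=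
  fun i => ((P.parts.sort (· ≤ ·)).reverse).getD i 0

/-- The parts of `P : Nat.Partition n` as a vector of length `n`. -/
def pfin {n : ℕ} (P : n.Partition) : Fin n → ℕ := fun k => pf P k

/-- Number of cells of the skew shape `a/b` where the filling `T` has entry `k`. -/
def skewContent (a b : ℕ → ℕ) (T : ℕ → ℕ → ℕ) (k : ℕ) : ℕ :=
  Nat.card {p : ℕ × ℕ // b p.1 ≤ p.2 ∧ p.2 < a p.1 ∧ T p.1 p.2 = k}

/-- Number of cells of the skew shape `a/b`. -/
def skewSize (a b : ℕ → ℕ) : ℕ :=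
  Nat.card {p : ℕ × ℕ // b p.1 ≤ p.2 ∧ p.2 < a p.1}

/-- `T` is a semistandard filling of the shape `a` (zero outside, rows weakly increasing,
columns strictly increasing). -/
def IsSSYT (a : ℕ → ℕ) (T : ℕ → ℕ → ℕ) : Prop :=
  (∀ i j, a i ≤ j → T i j = 0) ∧
  (∀ i j₁ j₂, j₁ ≤ j₂ → j₂ < a i → T i j₁ ≤ T i j₂) ∧
  (∀ i₁ i₂ j, i₁ < i₂ → j < a i₂ → T i₁ j < T i₂ j)

/-- The Kostka number: the number of semistandard Young tableaux of shape `a`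
and content `c`. -/
def kostka (a c : ℕ → ℕ) : ℕ :=
  Nat.card {T : ℕ → ℕ → ℕ // IsSSYT a T ∧ ∀ k, skewContent a (fun _ => 0) T k = c k}

/-- Number of entries equal to `k` in the prefix of the (right-to-left, top-to-bottom)
reading word of `T` ending at position `(i,j)`. -/
def lrCount (a b : ℕ → ℕ) (T : ℕ → ℕ → ℕ) (i j k : ℕ) : ℕ :=
  Nat.card {p : ℕ × ℕ //
    (p.1 < i ∨ (p.1 = i ∧ j ≤ p.2)) ∧ b p.1 ≤ p.2 ∧ p.2 < a p.1 ∧ T p.1 p.2 = k}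

/-- `T` is a Littlewood–Richardson skew tableau of shape `a/b`: semistandard and its
reverse reading word is a lattice word. -/
def IsLR (a b : ℕ → ℕ) (T : ℕ → ℕ → ℕ) : Prop :=
  (∀ i j, ¬(b i ≤ j ∧ j < a i) → T i j = 0) ∧
  (∀ i j₁ j₂, b i ≤ j₁ → j₁ ≤ j₂ → j₂ < a i → T i j₁ ≤ T i j₂) ∧
  (∀ i₁ i₂ j, i₁ < i₂ → b i₁ ≤ j → j < a i₁ → b i₂ ≤ j → j < a i₂ → T i₁ j < T i₂ j) ∧
  (∀ i j k, lrCount a b T i j (k + 1) ≤ lrCount a b T i j k)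

/-- A Littlewood–Richardson multitableau of shape `α` with `r` parts: a chain of
partitions `0 = α(0) ⊆ α(1) ⊆ ⋯ ⊆ α(r) = α` together with Littlewood–Richardson
fillings of the successive skew shapes. -/
structure LRMultiF (r : ℕ) (α : ℕ → ℕ) where
  chain : Fin (r + 1) → ℕ → ℕ
  antitone : ∀ k i j, i ≤ j → chain k j ≤ chain k i
  zero : ∀ i, chain 0 i = 0
  last : ∀ i, chain (Fin.last r) i = α i
  mono : ∀ (k : Fin r) (i : ℕ), chain k.castSucc i ≤ chain k.succ i
  T : Fin r → ℕ → ℕ → ℕ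
  lr : ∀ k : Fin r, IsLR (chain k.succ) (chain k.castSucc) (T k)

/-- Content of the `k`-th tableau of a Littlewood–Richardson multitableau. -/
def LRMultiF.cont {r : ℕ} {α : ℕ → ℕ} (M : LRMultiF r α) (k : Fin r) : ℕ → ℕ :=
  skewContent (M.chain k.succ) (M.chain k.castSucc) (M.T k)

/-- Size of the `k`-th tableau of a Littlewood–Richardson multitableau. -/
def LRMultiF.size {r : ℕ} {α : ℕ → ℕ} (M : LRMultiF r α) (k : Fin r) : ℕ :=
  skewSize (M.chain k.succ) (M.chain k.castSucc)

/-- `LR(α,β;ν)`: pairs of Littlewood–Richardson multitableaux of shapes `α`, `β`,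
type `ν`, with equal contents. -/
def LRPairs (r : ℕ) (α β : ℕ → ℕ) (ν : Fin r → ℕ) :=
  {TS : LRMultiF r α × LRMultiF r β //
    (∀ k, TS.1.size k = ν k) ∧ (∀ k, TS.2.size k = ν k) ∧ ∀ k, TS.1.cont k = TS.2.cont k}

/-- `LR*(α,β;ν)`: pairs of Littlewood–Richardson multitableaux of shapes `α`, `β`,
type `ν`, with termwise conjugate contents. -/
def LRPairsStar (n r : ℕ) (α β : ℕ → ℕ) (ν : Fin r → ℕ) :=
  {TS : LRMultiF r α × LRMultiF r β //
    (∀ k, TS.1.size k = ν k) ∧ (∀ k, TS.2.size k = ν k) ∧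
      ∀ k m, TS.2.cont k m = conjFun n (TS.1.cont k) m}

/-- `lr(α,β;ν)`. -/
def lrNum (r : ℕ) (α β : ℕ → ℕ) (ν : Fin r → ℕ) : ℕ := Nat.card (LRPairs r α β ν)

/-- `lr*(α,β;ν)`. -/
def lrStarNum (n r : ℕ) (α β : ℕ → ℕ) (ν : Fin r → ℕ) : ℕ :=
  Nat.card (LRPairsStar n r α β ν)

/-- A semistandard Young tableau (of arbitrary partition shape). -/
structure SSYTP where
  shape : ℕ → ℕ
  T : ℕ → ℕ → ℕ
  antitone : ∀ i j, i ≤ j → shape j ≤ shape i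
  finite : ∃ N, ∀ i, N ≤ i → shape i = 0
  ssyt : IsSSYT shape T

/-- Content of a semistandard Young tableau. -/
def SSYTP.cont (P : SSYTP) : ℕ → ℕ := skewContent P.shape (fun _ => 0) P.T

/-- The multiset of entries of a matrix. -/
def entriesM {p q : ℕ} (A : Fin p → Fin q → ℕ) : Multiset ℕ :=
  (Finset.univ : Finset (Fin p × Fin q)).val.map (fun ij => A ij.1 ij.2)

/-- The π-sequence of `A` is the partition `ν` (the weakly decreasing rearrangement of
the entries of `A` is `ν`). -/
def HasPiSeq {p q : ℕ} (A : Fin p → Fin q → ℕ) {n : ℕ} (ν : n.Partition) : Prop :=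
  (entriesM A).filter (· ≠ 0) = ν.parts

end

/-- `G i k` is the end of the cells with entries `< k` in row `i` of a semistandard filling of the
skew shape `a/b` with at most `P` rows and entries `< q`. -/
structure IsGT (P q : ℕ) (b a : ℕ → ℕ) (G : ℕ → ℕ → ℕ) : Prop where
  zero : ∀ i, G i 0 = b i
  mono : ∀ i k, G i k ≤ G i (k + 1)
  il : ∀ i k, G (i + 1) (k + 1) ≤ G i k
  last : ∀ i k, q ≤ k → G i k = a i
  row : ∀ i k, P ≤ i → G i k = 0

lemma IsGT.monotone {P q : ℕ} {b a : ℕ → ℕ} {G : ℕ → ℕ → ℕ} (h : IsGT P q b a G) (i : ℕ) :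
    Monotone (G i) :=
  monotone_nat_of_le_succ (h.mono i)

lemma IsGT.le_last {P q : ℕ} {b a : ℕ → ℕ} {G : ℕ → ℕ → ℕ} (h : IsGT P q b a G) (i k : ℕ) :
    G i k ≤ a i := by
  rw [← h.last i (max q k) (le_max_left _ _)]
  exact h.monotone i (le_max_right _ _)

lemma IsGT.first_le {P q : ℕ} {b a : ℕ → ℕ} {G : ℕ → ℕ → ℕ} (h : IsGT P q b a G) (i k : ℕ) :
    b i ≤ G i k := by
  rw [← h.zero i]
  exact h.monotone i (Nat.zero_le _)

lemma isGT_finite (P q : ℕ) (b a : ℕ → ℕ) : {G | IsGT P q b a G}.Finite := by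
  refine Set.Finite.of_injOn (t := Set.Iic (fun (i : Fin P) (_ : Fin q) => a i))
    (f := fun G (i : Fin P) (k : Fin q) => G i k) ?_ ?_ (Set.finite_Iic _)
  · intro G hG i k
    exact IsGT.le_last hG i k
  · intro G hG G' hG' h
    funext i k
    by_cases hi : P ≤ i
    · rw [IsGT.row hG i k hi, IsGT.row hG' i k hi]
    by_cases hk : q ≤ k
    · rw [IsGT.last hG i k hk, IsGT.last hG' i k hk]
    exact congrFun (congrFun h ⟨i, not_le.1 hi⟩) ⟨k, not_le.1 hk⟩

/-- The finite set of all Gelfand–Tsetlin patterns `IsGT P q b a`. -/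
noncomputable def gtSet (P q : ℕ) (b a : ℕ → ℕ) : Finset (ℕ → ℕ → ℕ) :=
  (isGT_finite P q b a).toFinset

@[simp] lemma mem_gtSet {P q : ℕ} {b a : ℕ → ℕ} {G : ℕ → ℕ → ℕ} :
    G ∈ gtSet P q b a ↔ IsGT P q b a G := by
  simp [gtSet]

/-- Number of entries `k` in the first `P` rows. -/
def wt (P : ℕ) (G : ℕ → ℕ → ℕ) (k : ℕ) : ℕ := ∑ j ∈ range P, (G j (k + 1) - G j k)

lemma wt_add {P : ℕ} {G : ℕ → ℕ → ℕ} (h : ∀ i k, G i k ≤ G i (k + 1)) (k : ℕ) :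
    wt P G k + ∑ j ∈ range P, G j k = ∑ j ∈ range P, G j (k + 1) := by
  rw [wt, ← sum_add_distrib]
  exact sum_congr rfl fun j _ => Nat.sub_add_cancel (h j k)

lemma wt_succ (P : ℕ) (G : ℕ → ℕ → ℕ) (k : ℕ) :
    wt (P + 1) G k = wt P G k + (G P (k + 1) - G P k) := by
  rw [wt, sum_range_succ, wt]

/-- Interlacing of three consecutive columns of a pattern. -/
def Interlace (u v w : ℕ → ℕ) : Prop :=
  ∀ j, u j ≤ v j ∧ v j ≤ w j ∧ v (j + 1) ≤ u j ∧ w (j + 1) ≤ v j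

/-- The Bender–Knuth involution applied to the part of the middle column starting at row `i`,
after discarding the last `t` cells of that row. -/
def bkCol (i t : ℕ) (u v w : ℕ → ℕ) (j : ℕ) : ℕ :=
  if j < i then v j
  else (if j = i then w i - t else min (u (j - 1)) (w j)) + max (u j) (w (j + 1)) - v j

/-- The condition under which `bkCol` preserves interlacing. -/
def BKOk (i t : ℕ) (u v w : ℕ → ℕ) : Prop :=
  v i + t ≤ w i ∧ ∀ j, i = j + 1 → w i ≤ u j + t

lemma bkCol_bounds {i t : ℕ} {u v w : ℕ → ℕ} (h : Interlace u v w) (hk : BKOk i t u v w) (j : ℕ)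
    (hj : i ≤ j) :
    max (u j) (w (j + 1)) ≤ bkCol i t u v w j ∧
      bkCol i t u v w j ≤ (if j = i then w i - t else min (u (j - 1)) (w j)) ∧
      bkCol i t u v w j + v j =
        (if j = i then w i - t else min (u (j - 1)) (w j)) + max (u j) (w (j + 1)) := by
  obtain ⟨h1, h2, h3, h4⟩ := h j
  have h5 := hk.1
  unfold bkCol
  rw [if_neg (not_lt.2 hj)]
  have hm : max (u j) (w (j + 1)) ≤ v j := max_le h1 h4
  by_cases hij : j = i
  · subst hij
    simp only [if_true]
    omega
  · simp only [hij, if_false]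
    obtain ⟨j, rfl⟩ : ∃ j', j = j' + 1 := ⟨j - 1, by omega⟩
    have := (h j).2.2.1
    have hm' : v (j + 1) ≤ min (u j) (w (j + 1)) := le_min this h2
    simp only [Nat.add_sub_cancel]
    omega

lemma bkCol_interlace {i t : ℕ} {u v w : ℕ → ℕ} (h : Interlace u v w) (hk : BKOk i t u v w) :
    Interlace u (bkCol i t u v w) w := by
  intro j
  have hlt : ∀ j, j < i → bkCol i t u v w j = v j := fun j hj => by simp [bkCol, hj]
  obtain ⟨h1, h2, h3, h4⟩ := h j
  have A : u j ≤ bkCol i t u v w j ∧ bkCol i t u v w j ≤ w j ∧ w (j + 1) ≤ bkCol i t u v w j := by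
    rcases lt_or_ge j i with hj | hj
    · rw [hlt j hj]; exact ⟨h1, h2, h4⟩
    · obtain ⟨a1, a2, -⟩ := bkCol_bounds h hk j hj
      refine ⟨(le_max_left _ _).trans a1, a2.trans ?_, (le_max_right _ _).trans a1⟩
      split_ifs with e
      · subst e; omega
      · exact min_le_right _ _
  refine ⟨A.1, A.2.1, ?_, A.2.2⟩
  rcases lt_or_ge (j + 1) i with hj | hj
  · rw [hlt _ hj]; exact h3
  · obtain ⟨-, a2, -⟩ := bkCol_bounds h hk (j + 1) hj
    refine a2.trans ?_
    split_ifs with e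
    · have := hk.2 j e.symm; omega
    · exact min_le_left _ _

lemma bkCol_ok {i t : ℕ} {u v w : ℕ → ℕ} (h : Interlace u v w) (hk : BKOk i t u v w) :
    BKOk i t u (bkCol i t u v w) w := by
  refine ⟨?_, hk.2⟩
  obtain ⟨-, a2, -⟩ := bkCol_bounds h hk i le_rfl
  have := hk.1
  simp only [if_true] at a2
  omega

lemma bkCol_bkCol {i t : ℕ} {u v w : ℕ → ℕ} (h : Interlace u v w) (hk : BKOk i t u v w) :
    bkCol i t u (bkCol i t u v w) w = v := by
  funext j
  rcases lt_or_ge j i with hj | hj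
  · simp [bkCol, hj]
  · have e1 := (bkCol_bounds h hk j hj).2.2
    have e2 := (bkCol_bounds (bkCol_interlace h hk) (bkCol_ok h hk) j hj).2.2
    omega

lemma bkCol_sum_aux {i t : ℕ} {u v w : ℕ → ℕ} (h : Interlace u v w) (hk : BKOk i t u v w) (m : ℕ) :
    ∑ j ∈ range (m + 1), bkCol i t u v w (i + j) + ∑ j ∈ range (m + 1), v (i + j)
      + min (u (i + m)) (w (i + m + 1)) + t
      = ∑ j ∈ range (m + 1), u (i + j) + ∑ j ∈ range (m + 2), w (i + j) := by
  induction m with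
  | zero =>
    have := (bkCol_bounds h hk i le_rfl).2.2
    simp only [if_true] at this
    have h5 := hk.1
    simp [sum_range_succ]
    omega
  | succ m ih =>
    have := (bkCol_bounds h hk (i + (m + 1)) (by omega)).2.2
    rw [if_neg (by omega), show i + (m + 1) - 1 = i + m by omega] at this
    rw [sum_range_succ, sum_range_succ _ (m + 1), sum_range_succ _ (m + 1),
      sum_range_succ _ (m + 2)]
    simp only [← add_assoc, show i + m + 1 + 1 = i + m + 2 from rfl] at *
    omega

lemma bkCol_sum {i t P : ℕ} {u v w : ℕ → ℕ} (h : Interlace u v w) (hk : BKOk i t u v w)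
    (hP : w P = 0) (hi : i < P) :
    ∑ j ∈ range P, bkCol i t u v w j + ∑ j ∈ range P, v j + t
        + (∑ j ∈ range i, u j + ∑ j ∈ range i, w j)
      = ∑ j ∈ range i, v j + ∑ j ∈ range i, v j + (∑ j ∈ range P, u j + ∑ j ∈ range P, w j) := by
  obtain ⟨m, rfl⟩ : ∃ m, P = i + (m + 1) := ⟨P - i - 1, by omega⟩
  have key := bkCol_sum_aux h hk m
  have hlt : ∑ j ∈ range i, bkCol i t u v w j = ∑ j ∈ range i, v j :=
    sum_congr rfl fun j hj => by simp [bkCol, mem_range.1 hj]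
  rw [sum_range_add _ i (m + 1), sum_range_add v i (m + 1), sum_range_add u i (m + 1),
    sum_range_add w i (m + 1), hlt]
  rw [sum_range_succ _ (m + 1)] at key
  rw [← add_assoc] at hP
  rw [← add_assoc i m 1, hP, Nat.min_zero] at key
  omega

/-- `bkCol` applied to column `k + 1` of a pattern. -/
def bk (i t k : ℕ) (G : ℕ → ℕ → ℕ) : ℕ → ℕ → ℕ := fun j =>
  Function.update (G j) (k + 1)
    (bkCol i t (fun j => G j k) (fun j => G j (k + 1)) (fun j => G j (k + 2)) j)

lemma bk_of_ne {i t k : ℕ} {G : ℕ → ℕ → ℕ} {j k' : ℕ} (h : k' ≠ k + 1) :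
    bk i t k G j k' = G j k' := by
  simp [bk, Function.update_of_ne h]

lemma bk_self {i t k : ℕ} {G : ℕ → ℕ → ℕ} {j : ℕ} :
    bk i t k G j (k + 1) =
      bkCol i t (fun j => G j k) (fun j => G j (k + 1)) (fun j => G j (k + 2)) j := by
  simp [bk]

lemma bk_of_lt {i t k : ℕ} {G : ℕ → ℕ → ℕ} {j k' : ℕ} (h : j < i) :
    bk i t k G j k' = G j k' := by
  by_cases hk : k' = k + 1
  · subst hk; rw [bk_self]; simp [bkCol, h]
  · exact bk_of_ne hk

section
variable {P q : ℕ} {b a : ℕ → ℕ} {G : ℕ → ℕ → ℕ}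

lemma IsGT.interlace (h : IsGT P q b a G) (k : ℕ) :
    Interlace (fun j => G j k) (fun j => G j (k + 1)) (fun j => G j (k + 2)) :=
  fun _ => ⟨h.mono _ _, h.mono _ _, h.il _ _, h.il _ _⟩

/-- `BKOk` for three consecutive columns of a pattern. -/
abbrev GTOk (i t k : ℕ) (G : ℕ → ℕ → ℕ) : Prop :=
  BKOk i t (fun j => G j k) (fun j => G j (k + 1)) (fun j => G j (k + 2))

lemma IsGT.bk (h : IsGT P q b a G) {i t k : ℕ} (hk : k + 1 < q)
    (ok : GTOk i t k G) : IsGT P q b a (bk i t k G) := by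
  have hI := bkCol_interlace (h.interlace k) ok
  refine ⟨fun _ => ?_, fun j k' => ?_, fun j k' => ?_, fun j k' hk' => ?_, fun j k' hj => ?_⟩
  · rw [bk_of_ne (by omega), h.zero]
  · by_cases e1 : k' = k + 1
    · subst e1; rw [bk_self, bk_of_ne (by omega)]; exact (hI j).2.1
    · by_cases e2 : k' = k
      · subst e2; rw [bk_self, bk_of_ne (by omega)]; exact (hI j).1
      · rw [bk_of_ne e1, bk_of_ne (by omega)]; exact h.mono _ _
  · by_cases e1 : k' = k + 1
    · subst e1; rw [bk_self, bk_of_ne (by omega)]; exact (hI j).2.2.2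
    · by_cases e2 : k' = k
      · subst e2; rw [bk_self, bk_of_ne (by omega)]; exact (hI j).2.2.1
      · rw [bk_of_ne e1, bk_of_ne (by omega)]; exact h.il _ _
  · rw [bk_of_ne (by omega), h.last _ _ hk']
  · by_cases e1 : k' = k + 1
    · subst e1; rw [bk_self]
      have h1 := (hI j).2.1
      have h2 : G j (k + 2) = 0 := h.row _ _ hj
      simp only [h2] at h1
      omega
    · rw [bk_of_ne e1, h.row _ _ hj]

lemma GTOk.bk (h : IsGT P q b a G) {i t k : ℕ} (ok : GTOk i t k G) : GTOk i t k (bk i t k G) := by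
  have := bkCol_ok (h.interlace k) ok
  have e : (fun j => _root_.bk i t k G j (k + 1)) = bkCol i t (fun j => G j k)
      (fun j => G j (k + 1)) (fun j => G j (k + 2)) := funext fun j => bk_self
  unfold GTOk
  rw [e]
  simpa only [bk_of_ne (show k ≠ k + 1 by omega), bk_of_ne (show k + 2 ≠ k + 1 by omega)] using this

lemma bk_bk (h : IsGT P q b a G) {i t k : ℕ} (ok : GTOk i t k G) :
    bk i t k (bk i t k G) = G := by
  funext j k'
  by_cases e1 : k' = k + 1
  · subst e1
    rw [bk_self]
    have e : (fun j => _root_.bk i t k G j (k + 1)) = bkCol i t (fun j => G j k)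
      (fun j => G j (k + 1)) (fun j => G j (k + 2)) := funext fun j => bk_self
    rw [e]
    simp only [bk_of_ne (show k ≠ k + 1 by omega), bk_of_ne (show k + 2 ≠ k + 1 by omega)]
    exact congrFun (bkCol_bkCol (h.interlace k) ok) j
  · rw [bk_of_ne e1, bk_of_ne e1]

lemma wt_bk_of_ne {i t k m k' : ℕ} (h1 : k' ≠ k) (h2 : k' ≠ k + 1) :
    wt m (bk i t k G) k' = wt m G k' :=
  sum_congr rfl fun j _ => by rw [bk_of_ne (by omega), bk_of_ne (by omega)]

lemma wt_bk_of_le {i t k m k' : ℕ} (h : m ≤ i) : wt m (bk i t k G) k' = wt m G k' :=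
  sum_congr rfl fun j hj => by
    rw [bk_of_lt ((mem_range.1 hj).trans_le h), bk_of_lt ((mem_range.1 hj).trans_le h)]

lemma wt_bk (h : IsGT P q b a G) {i t k : ℕ} (hi : i < P) (hk : k + 1 < q)
    (ok : GTOk i t k G) :
    wt P (bk i t k G) k + t + wt i G (k + 1) = wt i G k + wt P G (k + 1) ∧
    wt P (bk i t k G) (k + 1) + wt i G k = wt i G (k + 1) + wt P G k + t := by
  have S := bkCol_sum (P := P) (h.interlace k) ok (h.row _ _ le_rfl) hi
  have hb := (h.bk hk ok).mono
  have a1 := wt_add (P := P) hb k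
  have a2 := wt_add (P := P) hb (k + 1)
  have a3 := wt_add (P := P) h.mono k
  have a4 := wt_add (P := P) h.mono (k + 1)
  have a5 := wt_add (P := i) h.mono k
  have a6 := wt_add (P := i) h.mono (k + 1)
  simp only [bk_self, bk_of_ne (show k ≠ k + 1 by omega),
    bk_of_ne (show k + 1 + 1 ≠ k + 1 by omega)] at a1 a2
  simp only [show k + 1 + 1 = k + 2 from rfl] at *
  omega

end

/-- The lattice condition, starting from the content `c`, for the reading word of the tableau
encoded by `G`. -/
def Good (c : ℕ → ℕ) (G : ℕ → ℕ → ℕ) : Prop :=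
  ∀ i k, c (k + 1) + wt (i + 1) G (k + 1) ≤ c k + wt i G k

/-- For `x = (i, k)`, the lattice condition fails first in row `i`, and `k` is the largest letter
for which it does. -/
def FirstBad (c : ℕ → ℕ) (G : ℕ → ℕ → ℕ) (x : ℕ × ℕ) : Prop :=
  c x.2 + wt x.1 G x.2 < c (x.2 + 1) + wt (x.1 + 1) G (x.2 + 1) ∧
  (∀ i' < x.1, ∀ k, c (k + 1) + wt (i' + 1) G (k + 1) ≤ c k + wt i' G k) ∧
  (∀ k' > x.2, c (k' + 1) + wt (x.1 + 1) G (k' + 1) ≤ c k' + wt x.1 G k')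

lemma FirstBad.unique {c : ℕ → ℕ} {G : ℕ → ℕ → ℕ} {x y : ℕ × ℕ} (hx : FirstBad c G x)
    (hy : FirstBad c G y) : x = y := by
  obtain ⟨i, k⟩ := x
  obtain ⟨i', k'⟩ := y
  obtain ⟨a1, a2, a3⟩ := hx
  obtain ⟨b1, b2, b3⟩ := hy
  simp only at *
  have hi : i = i' := by
    rcases lt_trichotomy i i' with h | h | h
    · exact absurd (b2 i h k) (by omega)
    · exact h
    · exact absurd (a2 i' h k') (by omega)
  subst hi
  have hk : k = k' := by
    rcases lt_trichotomy k k' with h | h | h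
    · exact absurd (a3 k' h) (by omega)
    · exact h
    · exact absurd (b3 k h) (by omega)
  rw [hk]

section
variable {P q : ℕ} {b a c : ℕ → ℕ} {G : ℕ → ℕ → ℕ}

lemma IsGT.wt_eq_zero (h : IsGT P q b a G) {m k : ℕ} (hk : q ≤ k) : wt m G k = 0 :=
  sum_eq_zero fun j _ => by rw [h.last j _ hk, h.last j _ (by omega), Nat.sub_self]

lemma IsGT.row_bound (h : IsGT P q b a G) {i k : ℕ} (hi : P ≤ i) : wt i G k = wt P G k := by
  obtain ⟨m, rfl⟩ := Nat.exists_eq_add_of_le hi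
  rw [wt, sum_range_add, wt]
  simp [h.row]

lemma exists_firstBad (h : IsGT P q b a G) (hc : ∀ k, q ≤ k → c k = 0) (hg : ¬ Good c G) :
    ∃ x, FirstBad c G x := by
  have hex : ∃ i, ∃ k, ¬ c (k + 1) + wt (i + 1) G (k + 1) ≤ c k + wt i G k := by
    simpa [Good] using hg
  let i := Nat.find hex
  obtain ⟨k0, hk0⟩ : ∃ k, ¬ c (k + 1) + wt (i + 1) G (k + 1) ≤ c k + wt i G k := Nat.find_spec hex
  let p : ℕ → Prop := fun k => ¬ c (k + 1) + wt (i + 1) G (k + 1) ≤ c k + wt i G k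
  have hp : ∀ k, p k → k ≤ q := fun k hk => by
    by_contra hq
    apply hk
    rw [hc _ (by omega), h.wt_eq_zero (by omega)]
    omega
  refine ⟨(i, Nat.findGreatest p q), ?_, ?_, ?_⟩
  · exact not_le.1 (Nat.findGreatest_spec (P := p) (hp k0 hk0) hk0)
  · intro i' hi' k
    by_contra hh
    exact Nat.find_min hex hi' ⟨k, hh⟩
  · intro k hk
    by_contra hh
    exact Nat.findGreatest_is_greatest (P := p) hk (hp k hh) hh

/-- Number of cells discarded in row `x.1` up to and including the first violation. -/
def badCut (c : ℕ → ℕ) (G : ℕ → ℕ → ℕ) (x : ℕ × ℕ) : ℕ :=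
  c x.2 + wt x.1 G x.2 + 1 - (c (x.2 + 1) + wt x.1 G (x.2 + 1))

lemma FirstBad.props (h : IsGT P q b a G) (hc : ∀ k, q ≤ k → c k = 0) (hc' : Antitone c)
    {x : ℕ × ℕ} (hx : FirstBad c G x) :
    x.1 < P ∧ x.2 + 1 < q ∧ GTOk x.1 (badCut c G x) x.2 G ∧
      c (x.2 + 1) + wt x.1 G (x.2 + 1) ≤ c x.2 + wt x.1 G x.2 := by
  obtain ⟨i, k⟩ := x
  obtain ⟨a1, a2, a3⟩ := hx
  simp only at *
  have hck : c (k + 1) ≤ c k := hc' (Nat.le_succ k)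
  have hsucc := wt_succ i G (k + 1)
  have hle : c (k + 1) + wt i G (k + 1) ≤ c k + wt i G k ∧
      ∀ j, i = j + 1 → c (k + 1) + wt i G (k + 1) ≤ c k + wt j G k := by
    cases i with
    | zero => simpa [wt] using hck
    | succ i =>
      have := a2 i (by omega) k
      have h2 := wt_succ i G k
      refine ⟨by omega, fun j hj => ?_⟩
      obtain rfl : i = j := by omega
      exact this
  have hkq : k + 1 < q := by
    by_contra hq
    rw [hc (k + 1) (by omega), h.wt_eq_zero (k := k + 1) (by omega)] at a1
    omega
  have hiP : i < P := by
    by_contra hP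
    have : G i (k + 1 + 1) = 0 := h.row _ _ (by omega)
    omega
  refine ⟨hiP, hkq, ⟨?_, fun j hj => ?_⟩, hle.1⟩
  · simp only [badCut]
    have := h.mono i (k + 1)
    simp only [show k + 1 + 1 = k + 2 from rfl] at *
    omega
  · have h1 := hle.2 j hj
    simp only [badCut]
    subst hj
    have h2 := wt_succ j G k
    have h3 := h.mono j k
    have h4 : G (j + 1) (k + 1 + 1) ≤ G j (k + 1) := h.il j (k + 1)
    simp only [show k + 1 + 1 = k + 2 by rfl] at h4
    omega

/-- Bender–Knuth involution past the first violation `x` of the lattice condition. -/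
def bkFlip (c : ℕ → ℕ) (x : ℕ × ℕ) (G : ℕ → ℕ → ℕ) : ℕ → ℕ → ℕ := bk x.1 (badCut c G x) x.2 G

lemma badCut_bkFlip {x : ℕ × ℕ} : badCut c (bkFlip c x G) x = badCut c G x := by
  simp only [badCut, bkFlip, wt_bk_of_le le_rfl]

lemma firstBad_bkFlip (h : IsGT P q b a G) (hc : ∀ k, q ≤ k → c k = 0) (hc' : Antitone c)
    {x : ℕ × ℕ} (hx : FirstBad c G x) : FirstBad c (bkFlip c x G) x := by
  obtain ⟨h1, h2, ok, hle⟩ := hx.props h hc hc'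
  obtain ⟨a1, a2, a3⟩ := hx
  refine ⟨?_, fun i' hi' k => ?_, fun k' hk' => ?_⟩
  · have ok' := GTOk.bk h ok
    obtain ⟨hb, -⟩ := ok'
    rw [wt_succ, bkFlip, wt_bk_of_le le_rfl, wt_bk_of_le le_rfl]
    have : badCut c G x = c x.2 + wt x.1 G x.2 + 1 - (c (x.2 + 1) + wt x.1 G (x.2 + 1)) := rfl
    simp only [show x.2 + 1 + 1 = x.2 + 2 by rfl] at *
    omega
  · rw [bkFlip, wt_bk_of_le (by omega), wt_bk_of_le (by omega)]
    exact a2 i' hi' k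
  · rw [bkFlip, wt_bk_of_ne (by omega) (by omega), wt_bk_of_le le_rfl]
    exact a3 k' hk'

lemma isGT_bkFlip (h : IsGT P q b a G) (hc : ∀ k, q ≤ k → c k = 0) (hc' : Antitone c)
    {x : ℕ × ℕ} (hx : FirstBad c G x) : IsGT P q b a (bkFlip c x G) := by
  obtain ⟨h1, h2, ok, hle⟩ := hx.props h hc hc'
  exact h.bk h2 ok

lemma bkFlip_bkFlip (h : IsGT P q b a G) (hc : ∀ k, q ≤ k → c k = 0) (hc' : Antitone c)
    {x : ℕ × ℕ} (hx : FirstBad c G x) : bkFlip c x (bkFlip c x G) = G := by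
  obtain ⟨h1, h2, ok, hle⟩ := hx.props h hc hc'
  rw [bkFlip, badCut_bkFlip]
  exact bk_bk h ok

lemma wt_bkFlip (h : IsGT P q b a G) (hc : ∀ k, q ≤ k → c k = 0) (hc' : Antitone c)
    {x : ℕ × ℕ} (hx : FirstBad c G x) :
    c x.2 + wt P (bkFlip c x G) x.2 + 1 = c (x.2 + 1) + wt P G (x.2 + 1) ∧
    c (x.2 + 1) + wt P (bkFlip c x G) (x.2 + 1) = c x.2 + wt P G x.2 + 1 := by
  obtain ⟨h1, h2, ok, hle⟩ := hx.props h hc hc'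
  obtain ⟨e1, e2⟩ := wt_bk h h1 h2 ok
  have : badCut c G x = c x.2 + wt x.1 G x.2 + 1 - (c (x.2 + 1) + wt x.1 G (x.2 + 1)) := rfl
  unfold bkFlip
  omega

end

open MvPolynomial in
/-- The skew Schur polynomial of shape `a/b` in `q` variables. -/
noncomputable def schur (P q : ℕ) (b a : ℕ → ℕ) : MvPolynomial (Fin q) ℤ :=
  ∑ G ∈ gtSet P q b a, ∏ k : Fin q, X k ^ wt P G k

/-- The alternant `det (X_i ^ τ_j)`. -/
noncomputable def alternant (q : ℕ) (τ : ℕ → ℕ) : MvPolynomial (Fin q) ℤ :=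
  Matrix.det (Matrix.of fun i j : Fin q => MvPolynomial.X (R := ℤ) i ^ τ j)

lemma rename_swap_schur (P q : ℕ) (b a : ℕ → ℕ) (k : ℕ) (hk : k + 1 < q) :
    MvPolynomial.rename (swap (⟨k, by omega⟩ : Fin q) ⟨k + 1, hk⟩) (schur P q b a)
      = schur P q b a := by
  have ok : ∀ G, IsGT P q b a G → GTOk 0 0 k G := fun G hG => ⟨hG.mono _ _, by simp⟩
  simp only [schur, map_sum, map_prod, map_pow, MvPolynomial.rename_X]
  refine sum_nbij' (bk 0 0 k) (bk 0 0 k) ?_ ?_ ?_ ?_ ?_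
  · intro G hG
    rw [mem_gtSet] at hG ⊢
    exact hG.bk hk (ok G hG)
  · intro G hG
    rw [mem_gtSet] at hG ⊢
    exact hG.bk hk (ok G hG)
  · intro G hG
    rw [mem_gtSet] at hG
    exact bk_bk hG (ok G hG)
  · intro G hG
    rw [mem_gtSet] at hG
    exact bk_bk hG (ok G hG)
  · intro G hG
    rw [mem_gtSet] at hG
    rw [← Equiv.prod_comp (swap (⟨k, by omega⟩ : Fin q) ⟨k + 1, hk⟩)]
    refine prod_congr rfl fun j _ => ?_
    rw [swap_apply_self]
    congr 1
    have hw : wt P (bk 0 0 k G) k = wt P G (k + 1) ∧ wt P (bk 0 0 k G) (k + 1) = wt P G k := by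
      rcases Nat.eq_zero_or_pos P with rfl | hP
      · simp [wt]
      · simpa [wt] using wt_bk hG hP hk (ok G hG)
    by_cases h1 : j = ⟨k, by omega⟩
    · subst h1; rw [swap_apply_left]; exact hw.1.symm
    by_cases h2 : j = ⟨k + 1, hk⟩
    · subst h2; rw [swap_apply_right]; exact hw.2.symm
    rw [swap_apply_of_ne_of_ne h1 h2, wt_bk_of_ne]
    · exact fun h => h1 (Fin.ext h)
    · exact fun h => h2 (Fin.ext h)

lemma schur_isSymmetric (P q : ℕ) (b a : ℕ → ℕ) : (schur P q b a).IsSymmetric := by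
  intro σ
  cases q with
  | zero =>
    rw [Subsingleton.elim σ 1]
    simp
  | succ n =>
    have hσ : σ ∈ Submonoid.closure (Set.range fun i : Fin n => swap i.castSucc i.succ) := by
      rw [Equiv.Perm.mclosure_swap_castSucc_succ]; trivial
    induction hσ using Submonoid.closure_induction with
    | mem x hx =>
      obtain ⟨i, rfl⟩ := hx
      exact rename_swap_schur P (n + 1) b a i (by omega)
    | one => simp
    | mul x y _ _ hx hy =>
      rw [Perm.coe_mul, ← MvPolynomial.rename_rename, hy, hx]

lemma schur_mul_alternant (P q : ℕ) (b a τ : ℕ → ℕ) :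
    alternant q τ * schur P q b a = ∑ G ∈ gtSet P q b a, alternant q (fun k => τ k + wt P G k) := by
  simp only [alternant, Matrix.det_apply]
  rw [sum_mul, sum_comm]
  refine sum_congr rfl fun σ _ => ?_
  conv_lhs => rw [← schur_isSymmetric P q b a σ]
  simp only [schur, map_sum, map_prod, map_pow, MvPolynomial.rename_X, mul_sum, ← smul_sum,
    smul_mul_assoc, Matrix.of_apply, ← prod_mul_distrib, pow_add]

lemma alternant_swap (q : ℕ) (τ τ' : ℕ → ℕ) (k : ℕ) (hk : k + 1 < q) (h1 : τ' k = τ (k + 1))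
    (h2 : τ' (k + 1) = τ k) (h3 : ∀ j, j ≠ k → j ≠ k + 1 → τ' j = τ j) :
    alternant q τ' = - alternant q τ := by
  have hne : (⟨k, by omega⟩ : Fin q) ≠ ⟨k + 1, hk⟩ := by simp
  have := Matrix.det_permute' (swap (⟨k, by omega⟩ : Fin q) ⟨k + 1, hk⟩)
    (Matrix.of fun i j : Fin q => MvPolynomial.X (R := ℤ) i ^ τ j)
  rw [Perm.sign_swap hne] at this
  simp only [Units.val_neg, Units.val_one, Int.cast_neg, Int.cast_one, neg_one_mul] at this
  rw [alternant, alternant, ← this]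
  refine congrArg Matrix.det (Matrix.ext fun i j => ?_)
  simp only [Matrix.of_apply, Matrix.submatrix_apply, id]
  refine congrArg (MvPolynomial.X (R := ℤ) i ^ ·) ?_
  by_cases e1 : j = ⟨k, by omega⟩
  · subst e1; rw [swap_apply_left]; exact h1
  by_cases e2 : j = ⟨k + 1, hk⟩
  · subst e2; rw [swap_apply_right]; exact h2
  rw [swap_apply_of_ne_of_ne e1 e2]
  exact h3 _ (fun h => e1 (Fin.ext h)) (fun h => e2 (Fin.ext h))

/-- The staircase exponent. -/
def rho (q k : ℕ) : ℕ := q - 1 - k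

lemma alternant_rho_ne_zero (q : ℕ) : alternant q (rho q) ≠ 0 := by
  have := Matrix.det_permute' (Fin.revPerm)
    (Matrix.vandermonde (MvPolynomial.X (R := ℤ) : Fin q → _))
  have h2 : alternant q (rho q) = (Matrix.submatrix
      (Matrix.vandermonde (MvPolynomial.X (R := ℤ) : Fin q → _)) id Fin.revPerm).det := by
    rw [alternant]
    congr 1
    ext i j : 2
    simp only [rho, Matrix.vandermonde_apply, Matrix.of_apply, Matrix.submatrix_apply, id,
      Fin.revPerm_apply, Fin.val_rev, Nat.sub_sub, Nat.add_comm]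
  rw [h2, this]
  refine mul_ne_zero ?_ (Matrix.det_vandermonde_ne_zero_iff.2 (MvPolynomial.X_injective))
  rcases Int.units_eq_one_or (Perm.sign (Fin.revPerm (n := q))) with h | h <;> simp [h]

section
variable {P q : ℕ} {b a c : ℕ → ℕ}

lemma alternant_mul_schur (hc : ∀ k, q ≤ k → c k = 0) (hc' : Antitone c) :
    alternant q (fun k => c k + rho q k) * schur P q b a =
      ∑ G ∈ (gtSet P q b a).filter (Good c), alternant q (fun k => c k + wt P G k + rho q k) := by
  rw [schur_mul_alternant, ← sum_filter_add_sum_filter_not (gtSet P q b a) (Good c)]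
  have hB : ∑ G ∈ (gtSet P q b a).filter (fun G => ¬ Good c G),
      alternant q (fun k => c k + rho q k + wt P G k) = 0 := by
    have hx : ∀ G ∈ (gtSet P q b a).filter (fun G => ¬ Good c G), ∃ x, FirstBad c G x := by
      intro G hG
      rw [mem_filter, mem_gtSet] at hG
      exact exists_firstBad hG.1 hc hG.2
    choose x hx using hx
    have hcancel : ∀ G hG, alternant q (fun k => c k + rho q k + wt P (bkFlip c (x G hG) G) k) =
        - alternant q (fun k => c k + rho q k + wt P G k) := by
      intro G hG
      have hG' := mem_gtSet.1 (mem_filter.1 hG).1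
      obtain ⟨-, h2, -, -⟩ := (hx G hG).props hG' hc hc'
      obtain ⟨e1, e2⟩ := wt_bkFlip hG' hc hc' (hx G hG)
      refine alternant_swap q _ _ (x G hG).2 h2 ?_ ?_ ?_
      · simp only [rho]; omega
      · simp only [rho]; omega
      · intro j h1 h2
        rw [bkFlip, wt_bk_of_ne h1 h2]
    refine sum_involution (fun G hG => bkFlip c (x G hG) G) ?_ ?_ ?_ ?_
    · intro G hG
      rw [hcancel]; simp
    · intro G hG h0 he
      have := hcancel G hG
      rw [he] at this
      exact h0 (self_eq_neg.1 this)
    · intro G hG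
      have hG' := mem_gtSet.1 (mem_filter.1 hG).1
      rw [mem_filter, mem_gtSet]
      refine ⟨isGT_bkFlip hG' hc hc' (hx G hG), fun hg => ?_⟩
      have := (firstBad_bkFlip hG' hc hc' (hx G hG)).1
      exact absurd (hg _ _) (not_le.2 this)
    · intro G hG
      have hG' := mem_gtSet.1 (mem_filter.1 hG).1
      have e : x (bkFlip c (x G hG) G) (by
        rw [mem_filter, mem_gtSet]
        refine ⟨isGT_bkFlip hG' hc hc' (hx G hG), fun hg => ?_⟩
        have := (firstBad_bkFlip hG' hc hc' (hx G hG)).1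
        exact absurd (hg _ _) (not_le.2 this)) = x G hG :=
        (hx _ _).unique (firstBad_bkFlip hG' hc hc' (hx G hG))
      simp only [e]
      exact bkFlip_bkFlip hG' hc hc' (hx G hG)
  rw [hB, add_zero]
  refine sum_congr rfl fun G _ => ?_
  congr 1
  funext k
  omega

lemma wt_diag {m k : ℕ} :
    wt m (fun j k => if j < k then a j else 0) k = if k < m then a k else 0 := by
  have : (∑ j ∈ range m, if j = k then a j else 0) = if k < m then a k else 0 := by simp
  rw [wt, ← this]
  refine sum_congr rfl fun j _ => ?_
  split_ifs <;> omega

lemma good_zero_iff {G : ℕ → ℕ → ℕ} (ha' : ∀ k, q ≤ k → a k = 0) (ha : Antitone a)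
    (haP : ∀ k, P ≤ k → a k = 0) :
    (IsGT P q 0 a G ∧ Good 0 G) ↔ G = fun j k => if j < k then a j else 0 := by
  constructor
  · rintro ⟨h, hg⟩
    have h0 : ∀ k j, k ≤ j → G j k = 0 := by
      intro k
      induction k with
      | zero => intro j _; rw [h.zero]; rfl
      | succ k ih =>
        intro j hj
        obtain ⟨j, rfl⟩ : ∃ j', j = j' + 1 := ⟨j - 1, by omega⟩
        have := h.il j k
        rw [ih j (by omega)] at this
        omega
    have hw : ∀ k, wt k G k = 0 := by
      intro k
      induction k with
      | zero => rfl
      | succ k ih =>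
        have := hg k k
        rw [ih] at this
        simpa using this
    have h1 : ∀ j d, G j (j + 1 + d) = G j (j + 1) := by
      intro j d
      induction d with
      | zero => rfl
      | succ d ih =>
        have := hw (j + 1 + d)
        rw [wt, sum_eq_zero_iff] at this
        have h2 := this j (mem_range.2 (by omega))
        have h3 := h.mono j (j + 1 + d)
        rw [← add_assoc]
        omega
    funext j k
    split_ifs with hjk
    · have e1 := h1 j (k - j - 1)
      have e2 := h1 j q
      rw [show j + 1 + (k - j - 1) = k by omega] at e1
      rw [h.last _ _ (by omega)] at e2
      rw [e1, e2]
    · exact h0 _ _ (by omega)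
  · rintro rfl
    refine ⟨⟨fun i => by simp, fun i k => ?_, fun i k => ?_, fun i k hk => ?_, fun i k hi => ?_⟩,
      ?_⟩
    · split_ifs <;> omega
    · have := ha (Nat.le_succ i)
      split_ifs <;> omega
    · split_ifs with h
      · rfl
      · exact (ha' _ (by omega)).symm
    · simp [haP i hi]
    · intro i k
      simp only [Pi.zero_apply, zero_add]
      rw [wt_diag, wt_diag]
      have : a (k + 1) ≤ a k := ha (Nat.le_succ k)
      split_ifs <;> omega

/-- The bialternant formula. -/
lemma alternant_rho_mul_schur (ha' : ∀ k, q ≤ k → a k = 0) (ha : Antitone a)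
    (haP : ∀ k, P ≤ k → a k = 0) :
    alternant q (rho q) * schur P q 0 a = alternant q (fun k => a k + rho q k) := by
  have h := alternant_mul_schur (P := P) (q := q) (b := 0) (a := a) (c := 0) (fun _ _ => rfl)
    antitone_const
  have hs : (gtSet P q 0 a).filter (Good 0) = {fun j k => if j < k then a j else 0} := by
    ext G
    rw [mem_filter, mem_gtSet, good_zero_iff ha' ha haP, mem_singleton]
  rw [hs, sum_singleton] at h
  simp only [Pi.zero_apply, zero_add] at h
  change alternant q (fun k => rho q k) * _ = _
  rw [h]
  congr 1
  funext k
  rw [wt_diag]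
  split_ifs with hk
  · rfl
  · rw [haP k (by omega)]

lemma Good.antitone {G : ℕ → ℕ → ℕ} (h : IsGT P q b a G) (hg : Good c G) :
    Antitone (fun k => c k + wt P G k) := by
  refine antitone_nat_of_succ_le fun k => ?_
  have := hg P k
  rwa [h.row_bound (Nat.le_succ P)] at this

/-- Product of a Schur polynomial and a skew Schur polynomial. -/
lemma schur_mul_schur {P' : ℕ} (hc : ∀ k, q ≤ k → c k = 0) (hc' : Antitone c)
    (hP' : q ≤ P') :
    schur P' q 0 c * schur P q b a =
      ∑ G ∈ (gtSet P q b a).filter (Good c), schur P' q 0 (fun k => c k + wt P G k) := by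
  apply mul_left_cancel₀ (alternant_rho_ne_zero q)
  rw [← mul_assoc, alternant_rho_mul_schur hc hc' (fun k hk => hc k (by omega)),
    alternant_mul_schur hc hc', mul_sum]
  refine sum_congr rfl fun G hG => ?_
  rw [mem_filter, mem_gtSet] at hG
  have h0 : ∀ k, q ≤ k → c k + wt P G k = 0 := fun k hk => by
    rw [hc k hk, hG.1.wt_eq_zero hk]
  rw [alternant_rho_mul_schur h0 (hG.2.antitone hG.1) (fun k hk => h0 k (by omega))]

end

section
variable {P q : ℕ} {b a c : ℕ → ℕ} {G : ℕ → ℕ → ℕ}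

/-- The pattern of the transposed matrix of multiplicities. -/
def transposeGT (c : ℕ → ℕ) (G : ℕ → ℕ → ℕ) : ℕ → ℕ → ℕ := fun k j => c k + wt j G k

lemma wt_transposeGT (h : IsGT P q b a G) (m j : ℕ) :
    b j + wt m (transposeGT c G) j = G j m := by
  induction m with
  | zero => simp [wt, h.zero]
  | succ m ih =>
    rw [wt_succ, transposeGT, transposeGT, wt_succ, ← add_assoc, ih]
    have := h.mono j m
    omega

lemma IsGT.transpose (h : IsGT P q b a G) (hc : ∀ k, q ≤ k → c k = 0) (hg : Good c G) :
    IsGT q P c (fun k => c k + wt P G k) (transposeGT c G) ∧ Good b (transposeGT c G) ∧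
      (fun j => b j + wt q (transposeGT c G) j) = a := by
  refine ⟨⟨fun k => ?_, fun k j => ?_, fun k j => hg j k, fun k j hj => ?_, fun k j hk => ?_⟩,
    fun j k => ?_, funext fun j => ?_⟩
  · simp [transposeGT, wt]
  · simp only [transposeGT, wt_succ]; omega
  · simp only [transposeGT, h.row_bound hj]
  · simp only [transposeGT, hc k hk, h.wt_eq_zero hk]
  · rw [wt_transposeGT h, wt_transposeGT h]; exact h.il _ _
  · rw [wt_transposeGT h, h.last _ _ le_rfl]

lemma transposeGT_transposeGT (h : IsGT P q b a G) : transposeGT b (transposeGT c G) = G :=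
  funext fun j => funext fun m => wt_transposeGT h m j

lemma card_transpose (hb : ∀ k, P ≤ k → b k = 0) (hc : ∀ k, q ≤ k → c k = 0) (d : ℕ → ℕ) :
    #{G ∈ gtSet P q b a | Good c G ∧ (fun k => c k + wt P G k) = d} =
      #{G ∈ gtSet q P c d | Good b G ∧ (fun j => b j + wt q G j) = a} := by
  refine card_nbij' (transposeGT c) (transposeGT b) ?_ ?_ ?_ ?_
  · intro G hG
    simp only [coe_filter, mem_gtSet, Set.mem_ofPred_eq] at hG ⊢
    obtain ⟨h, hg, rfl⟩ := hG
    exact h.transpose hc hg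
  · intro G hG
    simp only [coe_filter, mem_gtSet, Set.mem_ofPred_eq] at hG ⊢
    obtain ⟨h, hg, rfl⟩ := hG
    exact h.transpose hb hg
  · intro G hG
    simp only [coe_filter, mem_gtSet, Set.mem_ofPred_eq] at hG
    exact transposeGT_transposeGT hG.1
  · intro G hG
    simp only [coe_filter, mem_gtSet, Set.mem_ofPred_eq] at hG
    exact transposeGT_transposeGT hG.1

lemma IsGT.change_rows {P' : ℕ} (h : IsGT P q b a G) (ha : ∀ k, P' ≤ k → a k = 0) :
    IsGT P' q b a G :=
  ⟨h.zero, h.mono, h.il, h.last, fun i k hi => by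
    have := h.le_last i k; rw [ha i hi] at this; omega⟩

lemma IsGT.wt_change_rows {P' : ℕ} (h : IsGT P q b a G) (h' : IsGT P' q b a G) (k : ℕ) :
    wt P G k = wt P' G k := by
  rw [← h.row_bound (le_max_left P P'), h'.row_bound (le_max_right P P')]

lemma card_change_rows {P' : ℕ} (ha : ∀ k, P ≤ k → a k = 0) (ha' : ∀ k, P' ≤ k → a k = 0)
    (p : (ℕ → ℕ → ℕ) → (ℕ → ℕ) → Prop) :
    #{G ∈ gtSet P q b a | p G (wt P G)} = #{G ∈ gtSet P' q b a | p G (wt P' G)} := by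
  congr 1
  ext G
  simp only [mem_filter, mem_gtSet]
  constructor
  · rintro ⟨h, hp⟩
    have h' := h.change_rows ha'
    rw [funext (h.wt_change_rows h')] at hp
    exact ⟨h', hp⟩
  · rintro ⟨h, hp⟩
    have h' := h.change_rows ha
    rw [funext (h.wt_change_rows h')] at hp
    exact ⟨h', hp⟩

lemma IsGT.sum_wt (h : IsGT P q b a G) :
    ∑ k ∈ range q, wt P G k + ∑ j ∈ range P, b j = ∑ j ∈ range P, a j := by
  simp only [wt]
  rw [sum_comm, ← sum_add_distrib]
  refine sum_congr rfl fun j _ => ?_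
  rw [sum_range_tsub (h.monotone j), h.zero, h.last j q le_rfl]
  have h1 := h.first_le j q
  rw [h.last j q le_rfl] at h1
  omega

lemma IsGT.eq_zero_of_le (h : IsGT P q 0 a G) {k j : ℕ} (hkj : k ≤ j) : G j k = 0 := by
  induction k generalizing j with
  | zero => rw [h.zero]; rfl
  | succ k ih =>
    obtain ⟨j, rfl⟩ : ∃ j', j = j' + 1 := ⟨j - 1, by omega⟩
    have := h.il j k
    rw [ih (by omega)] at this
    omega

lemma schur_eq_zero (ha : a q ≠ 0) : schur P q 0 a = 0 := by
  rw [schur]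
  refine sum_eq_zero fun G hG => ?_
  rw [mem_gtSet] at hG
  have h1 := hG.eq_zero_of_le (le_refl q)
  rw [hG.last _ _ le_rfl] at h1
  exact absurd h1 ha

lemma schur_mul_eq_sum {N : ℕ} (hb : ∀ k, P ≤ k → b k = 0) (hc : ∀ k, q ≤ k → c k = 0)
    (hc' : Antitone c) (hN : q ≤ N) (F : Finset (ℕ → ℕ))
    (hF : ∀ f ∈ F, Antitone f ∧ ∀ k, N ≤ k → f k = 0)
    (hmem : ∀ G, IsGT P q b a G → Good c G → (fun k => c k + wt P G k) ∈ F) :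
    schur N q 0 c * schur P q b a =
      ∑ f ∈ F, #{G ∈ gtSet N P c f | Good b G ∧ (fun j => b j + wt N G j) = a} •
        schur N q 0 f := by
  rw [schur_mul_schur hc hc' hN, ← sum_fiberwise_of_maps_to (t := F)
    (g := fun G k => c k + wt P G k)
    (fun G hG => hmem G (mem_gtSet.1 (mem_filter.1 hG).1) (mem_filter.1 hG).2)]
  refine sum_congr rfl fun f hf => ?_
  rw [sum_congr rfl (g := fun _ => schur N q 0 f)
    (fun G hG => by rw [← (mem_filter.1 hG).2]), sum_const, filter_filter, card_transpose hb hc]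
  by_cases hfq : f q = 0
  · have h0 : ∀ k, q ≤ k → f k = 0 := fun k hk => by
      have := (hF f hf).1 hk
      omega
    congr 1
    convert card_change_rows (q := P) (b := c) h0 (hF f hf).2
      (fun G w => Good b G ∧ (fun j => b j + w j) = a)
  · rw [schur_eq_zero hfq, smul_zero, smul_zero]

end

lemma IsPartitionFun.antitone {n : ℕ} {f : ℕ → ℕ} (h : IsPartitionFun n f) : Antitone f :=
  fun i j hij => h.1 i j hij

lemma IsPartitionFun.sum_range {n : ℕ} {f : ℕ → ℕ} (h : IsPartitionFun n f) {N : ℕ}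
    (hN : n ≤ N) : ∑ k ∈ range N, f k = n := by
  conv_rhs => rw [← h.2.2]
  exact (sum_subset (range_mono hN) fun k _ hk => h.2.1 k (by simpa using hk)).symm

lemma isPartitionFun_of_antitone {f : ℕ → ℕ} (hf : Antitone f) {K : ℕ} (h0 : ∀ k, K ≤ k → f k = 0) :
    IsPartitionFun (∑ k ∈ range K, f k) f := by
  have hz : ∀ k, ∑ k ∈ range K, f k ≤ k → f k = 0 := by
    intro k hk
    by_contra hne
    have h1 : ∀ j ∈ range (k + 1), 1 ≤ f j := fun j hj => by
      have := hf (Nat.lt_succ_iff.1 (mem_range.1 hj))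
      omega
    have hkK : k < K := by
      by_contra hh
      exact hne (h0 k (by omega))
    have h2 := sum_le_sum h1
    have h3 : ∑ j ∈ range (k + 1), f j ≤ ∑ j ∈ range K, f j :=
      sum_le_sum_of_subset (range_mono (by omega))
    simp at h2
    omega
  refine ⟨fun i j hij => hf hij, hz, ?_⟩
  rcases le_total K (∑ k ∈ range K, f k) with h | h
  · exact (sum_subset (range_mono h) fun k _ hk => h0 k (by simpa using hk)).symm
  · exact sum_subset (range_mono h) fun k _ hk => hz k (by simpa using hk)

lemma isPartitionFun_finite (n : ℕ) : {f | IsPartitionFun n f}.Finite := by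
  refine Set.Finite.of_injOn (t := Set.Iic (fun (_ : Fin n) => n))
    (f := fun f (i : Fin n) => f i) ?_ ?_ (Set.finite_Iic _)
  · intro f hf i
    have h := hf.2.2
    exact (single_le_sum (fun _ _ => Nat.zero_le _) (mem_range.2 i.2)).trans h.le
  · intro f hf g hg h
    funext i
    by_cases hi : n ≤ i
    · rw [hf.2.1 i hi, hg.2.1 i hi]
    · exact congrFun h ⟨i, not_le.1 hi⟩

/-- The partitions of `n`, as functions. -/
noncomputable def partFun (n : ℕ) : Finset (ℕ → ℕ) := (isPartitionFun_finite n).toFinset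

@[simp] lemma mem_partFun {n : ℕ} {f : ℕ → ℕ} : f ∈ partFun n ↔ IsPartitionFun n f := by
  simp [partFun]

/-- The Littlewood–Richardson rule for products of Schur polynomials. -/
lemma schur_mul_partition {N q m₁ m₂ : ℕ} {c d : ℕ → ℕ} (hq : q ≤ N) (hN : m₁ + m₂ ≤ N)
    (hc : IsPartitionFun m₁ c) (hd : IsPartitionFun m₂ d) :
    schur N q 0 c * schur N q 0 d =
      ∑ f ∈ partFun (m₁ + m₂), #{G ∈ gtSet N N c f | Good 0 G ∧ wt N G = d} •
        schur N q 0 f := by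
  by_cases hcq : c q = 0
  · have h0 : ∀ k, q ≤ k → c k = 0 := fun k hk => by
      have := hc.antitone hk
      omega
    rw [schur_mul_eq_sum (b := 0) (P := N) (fun _ _ => rfl) h0 hc.antitone hq (partFun (m₁ + m₂))]
    · simp only [Pi.zero_apply, zero_add]
    · intro f hf
      rw [mem_partFun] at hf
      exact ⟨hf.antitone, fun k hk => hf.2.1 k (by omega)⟩
    · intro G hG hg
      have hz : ∀ k, N ≤ k → c k + wt N G k = 0 := fun k hk => by
        rw [h0 k (by omega), hG.wt_eq_zero (by omega)]
      have := isPartitionFun_of_antitone (hg.antitone hG) hz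
      rw [sum_add_distrib, hc.sum_range (by omega)] at this
      have e : ∑ k ∈ range N, wt N G k = m₂ := by
        have e1 := hG.sum_wt
        simp only [Pi.zero_apply, sum_const_zero, add_zero] at e1
        rw [hd.sum_range (by omega)] at e1
        rw [← e1]
        exact (sum_subset (range_mono hq) fun k _ hk => hG.wt_eq_zero (by simpa using hk)).symm
      rw [e] at this
      exact mem_partFun.2 this
  · rw [schur_eq_zero hcq, zero_mul]
    refine (sum_eq_zero fun f _ => ?_).symm
    by_cases hfq : f q = 0
    · rw [card_eq_zero.2, zero_smul]
      refine filter_eq_empty_iff.2 fun G hG _ => hcq ?_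
      rw [mem_gtSet] at hG
      have h1 := hG.first_le q N
      have h2 := hG.le_last q N
      omega
    · rw [schur_eq_zero hfq, smul_zero]

lemma schur_zero (N q : ℕ) : schur N q 0 0 = 1 := by
  have : gtSet N q 0 0 = {0} := by
    ext G
    rw [mem_gtSet, mem_singleton]
    constructor
    · intro h
      funext i k
      exact Nat.le_zero.1 (h.le_last i k)
    · rintro rfl
      exact ⟨fun _ => rfl, fun _ _ => le_rfl, fun _ _ => le_rfl, fun _ _ _ => rfl, fun _ _ _ => rfl⟩
  rw [schur, this, sum_singleton]
  simp [wt]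

lemma extc_of_lt {p : ℕ} (s : Fin p → ℕ) {i : ℕ} (h : i < p) : extc s i = s ⟨i, h⟩ := by
  simp [extc, h]

lemma extc_of_le {p : ℕ} (s : Fin p → ℕ) {i : ℕ} (h : p ≤ i) : extc s i = 0 := by
  simp [extc, h]

lemma extc_val {p : ℕ} (s : Fin p → ℕ) (i : Fin p) : extc s i = s i := extc_of_lt s i.2

lemma sum_range_extc {p : ℕ} (s : Fin p → ℕ) : ∑ i ∈ range p, extc s i = ∑ i, s i := by
  rw [← Fin.sum_univ_eq_sum_range]
  simp [extc_val]

/-- A matrix with prescribed row sums is a skew tableau whose rows are far apart. -/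
lemma sum_matrices_eq_schur {p q m : ℕ} (s : Fin p → ℕ) (hs : ∑ i, s i = m) :
    ∑ B ∈ Fintype.piFinset fun i => piAntidiag (univ : Finset (Fin q)) (s i),
        ∏ k : Fin q, MvPolynomial.X (R := ℤ) k ^ ∑ i, B i k =
      schur p q (fun i => (p - 1 - i) * m) (fun i => (p - 1 - i) * m + extc s i) := by
  have hB : ∀ B : Fin p → Fin q → ℕ,
      B ∈ (Fintype.piFinset fun i => piAntidiag (univ : Finset (Fin q)) (s i)) ↔
        ∀ i, ∑ k, B i k = s i := by
    intro B
    simp [Fintype.mem_piFinset, mem_piAntidiag]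
  let e : (Fin p → Fin q → ℕ) → ℕ → ℕ → ℕ := fun B j k => extc (fun i => extc (B i) k) j
  have e1 : ∀ B (i : Fin p) (k : Fin q), e B i k = B i k := fun B i k => by
    simp only [e, extc_val]
  have e2 : ∀ B i k, p ≤ i → e B i k = 0 := fun B i k h => extc_of_le _ h
  have e3 : ∀ B i k, q ≤ k → e B i k = 0 := fun B i k h => by
    by_cases hi : i < p
    · show extc (fun i => extc (B i) k) i = 0
      rw [extc_of_lt _ hi, extc_of_le _ h]
    · exact e2 B i k (not_lt.1 hi)
  have hsum : ∀ B j k, (∀ i, ∑ k, B i k = s i) → q ≤ k →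
      ∑ k' ∈ range k, e B j k' = extc s j := by
    intro B j k hB hk
    rw [← sum_subset (range_mono hk) fun k' _ hk' => e3 B j k' (by simpa using hk')]
    by_cases hj : j < p
    · rw [extc_of_lt s hj, ← hB, ← Fin.sum_univ_eq_sum_range]
      exact sum_congr rfl fun k _ => e1 B ⟨j, hj⟩ k
    · rw [extc_of_le s (not_lt.1 hj)]
      exact sum_eq_zero fun k _ => e2 B j k (not_lt.1 hj)
  have hsm : ∀ i, extc s i ≤ m := by
    intro i
    by_cases hi : i < p
    · rw [extc_of_lt s hi, ← hs]
      exact single_le_sum (f := s) (fun _ _ => Nat.zero_le _) (mem_univ _)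
    · rw [extc_of_le s (not_lt.1 hi)]; exact Nat.zero_le _
  rw [schur]
  refine sum_nbij' (fun B j k => (p - 1 - j) * m + ∑ k' ∈ range k, e B j k')
    (fun G i k => G i (k + 1) - G i k) ?_ ?_ ?_ ?_ ?_
  · intro B h
    rw [hB] at h
    rw [mem_gtSet]
    refine ⟨fun i => by simp, fun i k => ?_, fun i k => ?_, fun i k hk => ?_, fun i k hi => ?_⟩
    · rw [sum_range_succ]; omega
    · by_cases hi : i + 1 < p
      · have h1 : ∑ k' ∈ range (k + 1), e B (i + 1) k' ≤ m := by
          refine le_trans ?_ (hsm (i + 1))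
          rw [← hsum B (i + 1) (max q (k + 1)) h (le_max_left _ _)]
          exact sum_le_sum_of_subset (range_mono (le_max_right _ _))
        have h2 : p - 1 - i = (p - 1 - (i + 1)) + 1 := by omega
        rw [h2, add_mul, one_mul]
        omega
      · rw [sum_eq_zero fun k _ => e2 B (i + 1) k (by omega), show p - 1 - (i + 1) = 0 by omega]
        simp
    · rw [hsum B i k h hk]
    · rw [sum_eq_zero fun k _ => e2 B i k hi, show p - 1 - i = 0 by omega]
      simp
  · intro G hG
    rw [mem_gtSet] at hG
    rw [hB]
    intro i
    rw [Fin.sum_univ_eq_sum_range (fun k => G i (k + 1) - G i k), sum_range_tsub (hG.monotone i),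
      hG.zero, hG.last i q le_rfl, extc_val]
    omega
  · intro B _
    funext i k
    simp only [sum_range_succ, e1]
    omega
  · intro G hG
    rw [mem_gtSet] at hG
    funext j k
    have : ∀ k, e (fun i k => G i (k + 1) - G i k) j k = G j (k + 1) - G j k := by
      intro k
      by_cases hj : j < p
      · by_cases hk : k < q
        · exact e1 (fun i k => G i (k + 1) - G i k) ⟨j, hj⟩ ⟨k, hk⟩
        · rw [e3 _ _ _ (not_lt.1 hk), hG.last j k (not_lt.1 hk), hG.last j (k + 1) (by omega),
            Nat.sub_self]
      · rw [e2 _ _ _ (not_lt.1 hj), hG.row _ _ (not_lt.1 hj), hG.row _ _ (not_lt.1 hj)]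
    simp only [this]
    rw [sum_range_tsub (hG.monotone j), hG.zero]
    have h1 := hG.first_le j k
    omega
  · intro B _
    refine prod_congr rfl fun k _ => ?_
    congr 1
    rw [wt, ← Fin.sum_univ_eq_sum_range
      (fun j => (p - 1 - j) * m + ∑ k' ∈ range (k + 1), e B j k' -
        ((p - 1 - j) * m + ∑ k' ∈ range k, e B j k'))]
    refine sum_congr rfl fun i _ => ?_
    rw [sum_range_succ, e1]
    omega

/-- Cauchy's identity with prescribed row sums. -/
lemma cauchy_rows {p q m N : ℕ} (s : Fin p → ℕ) (hs : ∑ i, s i = m) (hq : q ≤ N) (hm : m ≤ N) :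
    ∑ B ∈ Fintype.piFinset fun i => piAntidiag (univ : Finset (Fin q)) (s i),
        ∏ k : Fin q, MvPolynomial.X (R := ℤ) k ^ ∑ i, B i k =
      ∑ f ∈ partFun m, #{G ∈ gtSet N p 0 f | wt N G = extc s} • schur N q 0 f := by
  rw [sum_matrices_eq_schur s hs, ← one_mul (schur p q _ _), ← schur_zero N q,
    schur_mul_eq_sum (c := 0) (N := N) ?_ (fun _ _ => rfl) antitone_const hq (partFun m)]
  · refine sum_congr rfl fun f _ => ?_
    congr 2
    ext G
    simp only [mem_filter, and_congr_right_iff, mem_gtSet]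
    intro hG
    have : (fun j => (p - 1 - j) * m + wt N G j) = (fun j => (p - 1 - j) * m + extc s j) ↔
        wt N G = extc s := by
      simp only [funext_iff, add_right_inj]
    rw [this, and_iff_right_iff_imp]
    intro hw i k
    have h1 : wt (i + 1) G (k + 1) ≤ extc s (k + 1) := by
      rw [← hw, ← hG.row_bound (le_max_left N (i + 1))]
      exact sum_le_sum_of_subset (range_mono (le_max_right _ _))
    show (p - 1 - (k + 1)) * m + wt (i + 1) G (k + 1) ≤ (p - 1 - k) * m + wt i G k
    by_cases hk : k + 1 < p
    · rw [extc_of_lt s hk] at h1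
      have h2 : s ⟨k + 1, hk⟩ ≤ m := by
        rw [← hs]; exact single_le_sum (f := s) (fun _ _ => Nat.zero_le _) (mem_univ _)
      rw [show p - 1 - k = (p - 1 - (k + 1)) + 1 by omega, add_mul, one_mul]
      omega
    · rw [extc_of_le s (not_lt.1 hk)] at h1
      rw [show p - 1 - (k + 1) = 0 by omega]
      omega
  · intro f hf
    rw [mem_partFun] at hf
    exact ⟨hf.antitone, fun k hk => hf.2.1 k (by omega)⟩
  · intro G hG hg
    have hz : ∀ k, q ≤ k → (0 : ℕ → ℕ) k + wt p G k = 0 := fun k hk => by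
      rw [hG.wt_eq_zero hk]; rfl
    have := isPartitionFun_of_antitone (hg.antitone hG) hz
    simp only [Pi.zero_apply, zero_add] at this ⊢
    have e1 := hG.sum_wt
    rw [sum_add_distrib, sum_range_extc, hs] at e1
    rw [mem_partFun]
    rwa [show ∑ k ∈ range q, wt p G k = m by omega] at this
  · intro k hk
    simp only [show p - 1 - k = 0 by omega, zero_mul]

/-- `T` is a semistandard filling of the skew shape `a/b`. -/
structure IsFill (b a : ℕ → ℕ) (T : ℕ → ℕ → ℕ) : Prop where
  zero : ∀ i j, ¬(b i ≤ j ∧ j < a i) → T i j = 0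
  row : ∀ i j₁ j₂, b i ≤ j₁ → j₁ ≤ j₂ → j₂ < a i → T i j₁ ≤ T i j₂
  col : ∀ i₁ i₂ j, i₁ < i₂ → b i₁ ≤ j → j < a i₁ → b i₂ ≤ j → j < a i₂ → T i₁ j < T i₂ j

/-- In row `i` of the filling `T` of `a/b`, the cells with entries less than `k` are those in the
columns less than `G i k`. -/
structure Encodes (b a : ℕ → ℕ) (T G : ℕ → ℕ → ℕ) : Prop where
  zero : ∀ i j, ¬(b i ≤ j ∧ j < a i) → T i j = 0
  le : ∀ i k, b i ≤ G i k
  ge : ∀ i k, G i k ≤ a i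
  lt_iff : ∀ i j k, b i ≤ j → j < a i → (T i j < k ↔ j < G i k)

section
variable {P N : ℕ} {b a : ℕ → ℕ} {T G : ℕ → ℕ → ℕ}

lemma Encodes.eq_filling {T' : ℕ → ℕ → ℕ} (h : Encodes b a T G) (h' : Encodes b a T' G) :
    T = T' := by
  funext i j
  by_cases hj : b i ≤ j ∧ j < a i
  · have h1 := (h.lt_iff i j (T' i j + 1) hj.1 hj.2).trans
      (h'.lt_iff i j (T' i j + 1) hj.1 hj.2).symm
    have h2 := (h.lt_iff i j (T i j + 1) hj.1 hj.2).trans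
      (h'.lt_iff i j (T i j + 1) hj.1 hj.2).symm
    omega
  · rw [h.zero i j hj, h'.zero i j hj]

lemma Encodes.eq_pattern {G' : ℕ → ℕ → ℕ} (h : Encodes b a T G) (h' : Encodes b a T G') :
    G = G' := by
  funext i k
  have key : ∀ G G' : ℕ → ℕ → ℕ, Encodes b a T G → Encodes b a T G' → G i k ≤ G' i k := by
    intro G G' h h'
    by_contra! hlt
    have h1 := h.ge i k
    have h2 := h'.le i k
    have := (h.lt_iff i (G' i k) k h2 (by omega)).symm.trans (h'.lt_iff i (G' i k) k h2 (by omega))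
    omega
  exact le_antisymm (key G G' h h') (key G' G h' h)

lemma IsFill.exists_encodes (h : IsFill b a T) (hba : ∀ i, b i ≤ a i) : ∃ G, Encodes b a T G := by
  refine ⟨fun i k => b i + #{j ∈ Ico (b i) (a i) | T i j < k}, h.zero,
    fun i k => Nat.le_add_right _ _, fun i k => ?_, fun i j k hj hj' => ?_⟩
  · have := card_filter_le (Ico (b i) (a i)) (fun j => T i j < k)
    rw [Nat.card_Ico] at this
    have := hba i
    omega
  · constructor
    · intro hT
      have : Ico (b i) (j + 1) ⊆ {j ∈ Ico (b i) (a i) | T i j < k} := by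
        intro j' hm
        rw [mem_Ico] at hm
        rw [mem_filter, mem_Ico]
        exact ⟨⟨hm.1, by omega⟩, (h.row i j' j hm.1 (by omega) hj').trans_lt hT⟩
      have := card_le_card this
      rw [Nat.card_Ico] at this
      omega
    · intro hlt
      by_contra! hT
      have : ({j ∈ Ico (b i) (a i) | T i j < k} : Finset ℕ) ⊆ Ico (b i) j := by
        intro j' hm
        rw [mem_filter, mem_Ico] at hm
        rw [mem_Ico]
        refine ⟨hm.1.1, ?_⟩
        by_contra! hjj
        have := h.row i j j' hj hjj hm.1.2
        omega
      have := card_le_card this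
      rw [Nat.card_Ico] at this
      omega

lemma IsGT.exists_encodes (h : IsGT P N b a G) : ∃ T, Encodes b a T G := by
  refine ⟨fun i j => if b i ≤ j ∧ j < a i then sInf {k | j < G i (k + 1)} else 0,
    fun i j hj => if_neg hj, h.first_le, h.le_last, fun i j k hj hj' => ?_⟩
  rw [if_pos ⟨hj, hj'⟩]
  constructor
  · intro hk
    have hne : {k | j < G i (k + 1)}.Nonempty := ⟨N, by
      rw [Set.mem_ofPred_eq, h.last i _ (Nat.le_succ N)]; exact hj'⟩
    have : j < G i (sInf {k | j < G i (k + 1)} + 1) := Nat.sInf_mem hne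
    exact this.trans_le (h.monotone i hk)
  · intro hk
    cases k with
    | zero => rw [h.zero] at hk; omega
    | succ k => exact Nat.lt_succ_of_le (Nat.sInf_le hk)

lemma Encodes.isGT (e : Encodes b a T G) (h : IsFill b a T) (hb : Antitone b) (ha : Antitone a)
    (h0 : ∀ i, P ≤ i → a i = 0) (hN : ∀ i j, b i ≤ j → j < a i → T i j < N) :
    IsGT P N b a G := by
  refine ⟨fun i => ?_, fun i k => ?_, fun i k => ?_, fun i k hk => ?_, fun i k hi => ?_⟩
  · have h1 := e.le i 0
    have h2 := e.ge i 0
    by_contra hne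
    have := e.lt_iff i (b i) 0 le_rfl (by omega)
    omega
  · by_contra! hlt
    have h1 := e.le i (k + 1)
    have h2 := e.ge i k
    have h3 := e.lt_iff i (G i (k + 1)) k h1 (by omega)
    have h4 := e.lt_iff i (G i (k + 1)) (k + 1) h1 (by omega)
    omega
  · by_contra! hlt
    have h1 := e.le i k
    have h2 := e.ge (i + 1) (k + 1)
    have h3 := ha (Nat.le_succ i)
    have h4 := hb (Nat.le_succ i)
    simp only [Nat.succ_eq_add_one] at h3 h4
    have h5 := e.lt_iff i (G i k) k h1 (by omega)
    have h6 := e.lt_iff (i + 1) (G i k) (k + 1) (by omega) (by omega)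
    have h7 := h.col i (i + 1) (G i k) (Nat.lt_succ_self i) h1 (by omega) (by omega) (by omega)
    omega
  · by_contra hne
    have h1 := e.le i k
    have h2 := e.ge i k
    have h3 := e.lt_iff i (G i k) k h1 (by omega)
    have h4 := hN i (G i k) h1 (by omega)
    omega
  · have := e.ge i k
    rw [h0 i hi] at this
    omega

lemma IsGT.antitone_rows (h : IsGT P N b a G) (k : ℕ) : Antitone fun i => G i k :=
  antitone_nat_of_succ_le fun i => (h.mono _ _).trans (h.il i k)

lemma Encodes.isFill (e : Encodes b a T G) (h : IsGT P N b a G) : IsFill b a T := by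
  refine ⟨e.zero, fun i j₁ j₂ h1 h2 h3 => ?_, fun i₁ i₂ j hi h1 h2 h3 h4 => ?_⟩
  · have a1 := e.lt_iff i j₂ (T i j₂ + 1) (by omega) h3
    have a2 := e.lt_iff i j₁ (T i j₂ + 1) h1 (by omega)
    omega
  · have a1 := e.lt_iff i₂ j (T i₂ j + 1) h3 h4
    have a2 := e.lt_iff i₁ j (T i₂ j) h1 h2
    have a3 : G i₂ (T i₂ j + 1) ≤ G (i₁ + 1) (T i₂ j + 1) := h.antitone_rows _ hi
    have a4 := h.il i₁ (T i₂ j)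
    omega

lemma Encodes.cell_iff (e : Encodes b a T G) (i j k : ℕ) :
    (b i ≤ j ∧ j < a i ∧ T i j = k) ↔ (G i k ≤ j ∧ j < G i (k + 1)) := by
  have h1 := e.le i k
  have h2 := e.ge i (k + 1)
  constructor
  · rintro ⟨h3, h4, h5⟩
    have := e.lt_iff i j k h3 h4
    have := e.lt_iff i j (k + 1) h3 h4
    omega
  · rintro ⟨h3, h4⟩
    have := e.lt_iff i j k (by omega) (by omega)
    have := e.lt_iff i j (k + 1) (by omega) (by omega)
    omega

lemma card_cells (P : ℕ) (f g : ℕ → ℕ) (h : ∀ i, P ≤ i → g i = 0) :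
    Nat.card {p : ℕ × ℕ // f p.1 ≤ p.2 ∧ p.2 < g p.1} = ∑ i ∈ range P, (g i - f i) := by
  rw [Nat.subtype_card (((range P).sigma fun i => Ico (f i) (g i)).map
    (Equiv.sigmaEquivProd ℕ ℕ).toEmbedding)]
  · simp
  · rintro ⟨i, j⟩
    simp only [mem_map_equiv, mem_sigma, mem_range, mem_Ico, sigmaEquivProd_symm_apply,
      and_iff_right_iff_imp]
    intro hij
    by_contra! hi
    rw [h i hi] at hij
    omega

lemma Encodes.skewContent_eq (e : Encodes b a T G) (h0 : ∀ i, P ≤ i → a i = 0) (k : ℕ) :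
    skewContent a b T k = wt P G k := by
  simp only [skewContent, e.cell_iff]
  exact card_cells P (fun i => G i k) (fun i => G i (k + 1)) fun i hi => by
    have := e.ge i (k + 1)
    rw [h0 i hi] at this
    omega

lemma Encodes.lrCount_eq (e : Encodes b a T G) (i j k : ℕ) :
    lrCount a b T i j k = wt i G k + (G i (k + 1) - max j (G i k)) := by
  have := card_cells (i + 1) (fun i' => if i' < i then G i' k else max j (G i k))
    (fun i' => if i' ≤ i then G i' (k + 1) else 0) (fun i' hi' => if_neg (by omega))
  rw [sum_range_succ, sum_congr rfl (g := fun i' => G i' (k + 1) - G i' k) ?_] at this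
  · simp only [lt_self_iff_false, if_false, le_refl, if_true] at this
    rw [wt, ← this, lrCount]
    refine Nat.card_congr (Equiv.subtypeEquivRight ?_)
    rintro ⟨i', j'⟩
    simp only [e.cell_iff]
    rcases lt_trichotomy i' i with hi | rfl | hi
    · simp [hi, hi.le]
    · simp [and_assoc]
    · simp [hi.not_gt, hi.not_ge, hi.ne']
  · intro i' hi'
    rw [mem_range] at hi'
    rw [if_pos hi', if_pos hi'.le]

lemma Encodes.lattice_iff (e : Encodes b a T G) (h : ∀ i k, G i k ≤ G i (k + 1)) :
    (∀ i j k, lrCount a b T i j (k + 1) ≤ lrCount a b T i j k) ↔ Good 0 G := by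
  simp only [e.lrCount_eq, Good, Pi.zero_apply, zero_add, wt_succ]
  constructor
  · intro H i k
    have := H i (G i (k + 1)) k
    have := h i k
    omega
  · intro H i j k
    have := H i k
    omega

lemma isLR_iff : IsLR a b T ↔
    IsFill b a T ∧ ∀ i j k, lrCount a b T i j (k + 1) ≤ lrCount a b T i j k :=
  ⟨fun h => ⟨⟨h.1, h.2.1, h.2.2.1⟩, h.2.2.2⟩, fun h => ⟨h.1.1, h.1.2, h.1.3, h.2⟩⟩

lemma isSSYT_iff (ha : Antitone a) : IsSSYT a T ↔ IsFill (fun _ => 0) a T := by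
  constructor
  · rintro ⟨h1, h2, h3⟩
    exact ⟨fun i j h => h1 i j (by simpa using h), fun i j₁ j₂ _ => h2 i j₁ j₂,
      fun i₁ i₂ j h _ _ _ => h3 i₁ i₂ j h⟩
  · rintro ⟨h1, h2, h3⟩
    refine ⟨fun i j h => h1 i j (by omega), fun i j₁ j₂ => h2 i j₁ j₂ (Nat.zero_le _),
      fun i₁ i₂ j h hj => h3 i₁ i₂ j h (Nat.zero_le _) ?_ (Nat.zero_le _) hj⟩
    exact hj.trans_le (ha h.le)

lemma Encodes.entry_lt (e : Encodes b a T G) (h0 : ∀ i, P ≤ i → a i = 0)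
    (hw : ∀ k, N ≤ k → wt P G k = 0) (i j : ℕ) (hj : b i ≤ j) (hj' : j < a i) : T i j < N := by
  by_contra! hN
  have h1 := (e.cell_iff i j (T i j)).1 ⟨hj, hj', rfl⟩
  have hi : i < P := by
    by_contra! hi
    rw [h0 i hi] at hj'
    omega
  have h2 := hw _ hN
  rw [wt, sum_eq_zero_iff] at h2
  have := h2 i (mem_range.2 hi)
  omega

/-- Fillings correspond to patterns. -/
lemma fillings_equiv_patterns (hb : Antitone b) (ha : Antitone a) (hba : ∀ i, b i ≤ a i)
    (h0 : ∀ i, P ≤ i → a i = 0) {γ : ℕ → ℕ} (hγ : ∀ k, N ≤ k → γ k = 0)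
    (Q p : (ℕ → ℕ → ℕ) → Prop) (hQ : ∀ T G, IsGT P N b a G → Encodes b a T G → (Q T ↔ p G)) :
    Nonempty ({T // IsFill b a T ∧ Q T ∧ ∀ k, skewContent a b T k = γ k} ≃
      {G // G ∈ {G ∈ gtSet P N b a | p G ∧ wt P G = γ}}) := by
  have key : ∀ T, IsFill b a T ∧ Q T ∧ (∀ k, skewContent a b T k = γ k) →
      ∃ G, G ∈ {G ∈ gtSet P N b a | p G ∧ wt P G = γ} ∧ Encodes b a T G := by
    rintro T ⟨h, hq, hc⟩
    obtain ⟨G, e⟩ := h.exists_encodes hba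
    have hw : wt P G = γ := funext fun k => by rw [← e.skewContent_eq h0, hc]
    have hG := e.isGT h hb ha h0 (e.entry_lt h0 fun k hk => by rw [hw, hγ k hk])
    exact ⟨G, mem_filter.2 ⟨mem_gtSet.2 hG, (hQ T G hG e).1 hq, hw⟩, e⟩
  choose F hF hF' using key
  refine ⟨Equiv.ofBijective (fun T => ⟨F T.1 T.2, hF T.1 T.2⟩) ⟨?_, ?_⟩⟩
  · rintro ⟨T, hT⟩ ⟨T', hT'⟩ h
    have h1 := hF' T hT
    simp only [Subtype.mk.injEq] at h
    rw [h] at h1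
    exact Subtype.ext (h1.eq_filling (hF' T' hT'))
  · rintro ⟨G, hG⟩
    have hG' := hG
    rw [mem_filter, mem_gtSet] at hG'
    obtain ⟨T, e⟩ := hG'.1.exists_encodes
    have hT : IsFill b a T ∧ Q T ∧ ∀ k, skewContent a b T k = γ k :=
      ⟨e.isFill hG'.1, (hQ T G hG'.1 e).2 hG'.2.1, fun k => by
        rw [e.skewContent_eq h0, hG'.2.2]⟩
    exact ⟨⟨T, hT⟩, Subtype.ext ((hF' T hT).eq_pattern e)⟩

lemma ssyt_equiv_patterns (ha : Antitone a) (h0 : ∀ i, P ≤ i → a i = 0) {γ : ℕ → ℕ}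
    (hγ : ∀ k, N ≤ k → γ k = 0) :
    Nonempty ({T // IsSSYT a T ∧ ∀ k, skewContent a (fun _ => 0) T k = γ k} ≃
      {G // G ∈ {G ∈ gtSet P N 0 a | wt P G = γ}}) := by
  have := fillings_equiv_patterns (b := fun _ => 0) (fun _ _ _ => le_rfl) ha (fun _ => Nat.zero_le _)
    h0 hγ (fun _ => True) (fun _ => True) (fun _ _ _ _ => Iff.rfl)
  simp only [true_and, ← isSSYT_iff ha] at this
  convert this
  rfl

lemma lr_equiv_patterns (hb : Antitone b) (ha : Antitone a) (hba : ∀ i, b i ≤ a i)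
    (h0 : ∀ i, P ≤ i → a i = 0) {γ : ℕ → ℕ} (hγ : ∀ k, N ≤ k → γ k = 0) :
    Nonempty ({T // IsLR a b T ∧ ∀ k, skewContent a b T k = γ k} ≃
      {G // G ∈ {G ∈ gtSet P N b a | Good 0 G ∧ wt P G = γ}}) := by
  have := fillings_equiv_patterns hb ha hba h0 hγ
    (fun T => ∀ i j k, lrCount a b T i j (k + 1) ≤ lrCount a b T i j k) (Good 0)
    (fun T G hG e => e.lattice_iff hG.mono)
  simp only [← and_assoc, ← isLR_iff] at this
  convert this

lemma IsLR.isPartitionFun_skewContent (h : IsLR a b T) (hb : Antitone b) (ha : Antitone a)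
    (hba : ∀ i, b i ≤ a i) (h0 : ∀ i, P ≤ i → a i = 0) :
    IsPartitionFun (skewSize a b) (skewContent a b T) := by
  rw [isLR_iff] at h
  obtain ⟨G, e⟩ := h.1.exists_encodes hba
  set N := (range P).sup (fun i => (range (a i)).sup (T i)) + 1 with hN
  have hG : IsGT P N b a G := by
    refine e.isGT h.1 hb ha h0 fun i j hj hj' => ?_
    have hi : i < P := by
      by_contra! hi
      rw [h0 i hi] at hj'
      omega
    rw [hN, Nat.lt_succ_iff]
    exact (le_sup (f := T i) (mem_range.2 hj')).trans
      (le_sup (f := fun i => (range (a i)).sup (T i)) (mem_range.2 hi))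
  have hg := (e.lattice_iff hG.mono).1 h.2
  have h1 := hg.antitone hG
  simp only [Pi.zero_apply, zero_add] at h1
  rw [funext (e.skewContent_eq h0)]
  convert isPartitionFun_of_antitone h1 (K := N) fun k hk => hG.wt_eq_zero hk using 1
  have h2 := hG.sum_wt
  rw [skewSize, card_cells P b a h0]
  have h3 : ∑ i ∈ range P, (a i - b i) + ∑ i ∈ range P, b i = ∑ i ∈ range P, a i := by
    rw [← sum_add_distrib]
    exact sum_congr rfl fun i _ => Nat.sub_add_cancel (hba i)
  omega

lemma IsGT.dominates (h : IsGT P N 0 a G) : Dominates a (wt P G) := by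
  intro k
  have h1 : ∑ k' ∈ range k, wt P G k' = ∑ i ∈ range P, G i k := by
    simp only [wt]
    rw [sum_comm]
    refine sum_congr rfl fun i _ => ?_
    rw [sum_range_tsub (h.monotone i), h.zero]
    simp
  rw [h1]
  calc ∑ i ∈ range P, G i k ≤ ∑ i ∈ range (max P k), G i k :=
        sum_le_sum_of_subset (range_mono (le_max_left _ _))
    _ = ∑ i ∈ range k, G i k :=
        (sum_subset (range_mono (le_max_right _ _)) fun i _ hi =>
          h.eq_zero_of_le (by simpa using hi)).symm
    _ ≤ _ := sum_le_sum fun i _ => h.le_last i k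

end

lemma IsPartitionFun.unique {n n' : ℕ} {f : ℕ → ℕ} (h : IsPartitionFun n f)
    (h' : IsPartitionFun n' f) : n = n' := by
  rw [← h.sum_range (le_max_left n n'), h'.sum_range (le_max_right n n')]

lemma fin_telescope {r : ℕ} (F : Fin (r + 1) → ℕ) (ν : Fin r → ℕ)
    (h : ∀ k : Fin r, F k.succ = F k.castSucc + ν k) : F (Fin.last r) = F 0 + ∑ k, ν k := by
  induction r with
  | zero => simp
  | succ r ih =>
    have h1 := ih (fun k => F k.castSucc) (fun k => ν k.castSucc) fun k => h k.castSucc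
    have h2 := h (Fin.last r)
    rw [Fin.sum_univ_castSucc, ← Fin.succ_last, h2, h1, Fin.castSucc_zero, add_assoc]

section
variable {r N : ℕ} {α : ℕ → ℕ}

lemma LRMultiF.chain_mono (M : LRMultiF r α) : Monotone M.chain :=
  Fin.monotone_iff_le_succ.2 fun k i => M.mono k i

lemma LRMultiF.chain_le (M : LRMultiF r α) (k : Fin (r + 1)) (i : ℕ) : M.chain k i ≤ α i := by
  rw [← M.last i]
  exact M.chain_mono (Fin.le_last k) i

lemma LRMultiF.chain_eq_zero (M : LRMultiF r α) (h0 : ∀ i, N ≤ i → α i = 0) (k : Fin (r + 1))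
    (i : ℕ) (hi : N ≤ i) : M.chain k i = 0 := by
  have := M.chain_le k i
  rw [h0 i hi] at this
  omega

lemma LRMultiF.isPartitionFun_cont (M : LRMultiF r α) (h0 : ∀ i, N ≤ i → α i = 0) (k : Fin r) :
    IsPartitionFun (M.size k) (M.cont k) :=
  (M.lr k).isPartitionFun_skewContent (fun i j => M.antitone _ i j) (fun i j => M.antitone _ i j)
    (M.mono k) (M.chain_eq_zero h0 _)

lemma LRMultiF.isPartitionFun (M : LRMultiF r α) (h0 : ∀ i, N ≤ i → α i = 0) :
    IsPartitionFun (∑ k, M.size k) α := by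
  have h1 := fin_telescope (fun k => ∑ i ∈ range N, M.chain k i) M.size fun k => by
    rw [LRMultiF.size, skewSize, card_cells N _ _ (M.chain_eq_zero h0 _), ← sum_add_distrib]
    refine sum_congr rfl fun i _ => ?_
    have := M.mono k i
    omega
  simp only [M.zero, sum_const_zero, zero_add, M.last] at h1
  rw [← h1]
  refine isPartitionFun_of_antitone (fun i j hij => ?_) h0
  rw [← M.last, ← M.last]
  exact M.antitone _ i j hij

/-- Restriction of a multitableau to all but the last piece. -/
def LRMultiF.init (M : LRMultiF (r + 1) α) : LRMultiF r (M.chain (Fin.last r).castSucc) where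
  chain j := M.chain j.castSucc
  antitone _ := M.antitone _
  zero := M.zero
  last _ := rfl
  mono k := M.mono k.castSucc
  T k := M.T k.castSucc
  lr k := M.lr k.castSucc

/-- Extension of a multitableau by one more piece. -/
def LRMultiF.snoc {α' : ℕ → ℕ} (M : LRMultiF r α') (hα : Antitone α) (hα' : ∀ i, α' i ≤ α i)
    (T : ℕ → ℕ → ℕ) (hT : IsLR α α' T) : LRMultiF (r + 1) α where
  chain := Fin.snoc (α := fun _ => ℕ → ℕ) M.chain α
  antitone k := by
    refine Fin.lastCases ?_ (fun k => ?_) k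
    · rw [Fin.snoc_last]; exact fun i j h => hα h
    · rw [Fin.snoc_castSucc]; exact M.antitone k
  zero := by
    rw [← Fin.castSucc_zero, Fin.snoc_castSucc]; exact M.zero
  last := by rw [Fin.snoc_last]; exact fun _ => rfl
  mono k := by
    refine Fin.lastCases ?_ (fun k => ?_) k
    · rw [Fin.succ_last, Fin.snoc_last, Fin.snoc_castSucc]
      exact fun i => (M.last i).trans_le (hα' i)
    · rw [Fin.succ_castSucc, Fin.snoc_castSucc, Fin.snoc_castSucc]; exact M.mono k
  T := Fin.snoc (α := fun _ => ℕ → ℕ → ℕ) M.T T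
  lr k := by
    refine Fin.lastCases ?_ (fun k => ?_) k
    · rw [Fin.succ_last, Fin.snoc_last, Fin.snoc_castSucc, Fin.snoc_last, funext M.last]
      exact hT
    · rw [Fin.succ_castSucc, Fin.snoc_castSucc, Fin.snoc_castSucc, Fin.snoc_castSucc]
      exact M.lr k

lemma LRMultiF.ext' {M M' : LRMultiF r α} (h : M.chain = M'.chain) (h' : M.T = M'.T) :
    M = M' := by
  cases M; cases M'; cases h; cases h'; rfl

/-- Littlewood–Richardson multitableaux of shape `α` with contents `γ`. -/
abbrev LRWithCont (r : ℕ) (γ : Fin r → ℕ → ℕ) (α : ℕ → ℕ) :=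
  {M : LRMultiF r α // ∀ k, M.cont k = γ k}

/-- Littlewood–Richardson tableaux of shape `a/b` with content `γ`. -/
abbrev LRTab (b a γ : ℕ → ℕ) :=
  {T : ℕ → ℕ → ℕ // (∀ i, b i ≤ a i) ∧ IsLR a b T ∧ ∀ k, skewContent a b T k = γ k}

/-- The number of Littlewood–Richardson multitableaux of shape `α` with contents `γ`. -/
noncomputable def lrCard (r : ℕ) (γ : Fin r → ℕ → ℕ) (α : ℕ → ℕ) : ℕ :=
  Nat.card (LRWithCont r γ α)

/-- Splitting off the last piece of a multitableau. -/
def lrFiberEquiv (hα : Antitone α) (γ : Fin (r + 1) → ℕ → ℕ) (α' : ℕ → ℕ) :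
    {M : LRWithCont (r + 1) γ α // M.1.chain (Fin.last r).castSucc = α'} ≃
      LRWithCont r (fun k => γ k.castSucc) α' × LRTab α' α (γ (Fin.last r)) where
  toFun := fun ⟨⟨M, hM⟩, h⟩ =>
    (⟨h ▸ M.init, by subst h; exact fun k => hM k.castSucc⟩,
      ⟨M.T (Fin.last r), by subst h; exact M.chain_le _, by
        subst h; have := M.lr (Fin.last r); rwa [Fin.succ_last, funext M.last] at this, by
        subst h
        intro k
        have := congrFun (hM (Fin.last r)) k
        rwa [LRMultiF.cont, Fin.succ_last, funext M.last] at this⟩)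
  invFun := fun ⟨⟨M, hM⟩, ⟨T, h1, h2, h3⟩⟩ => ⟨⟨M.snoc hα h1 T h2, by
    refine fun k => Fin.lastCases ?_ (fun k => ?_) k
    · simp only [LRMultiF.cont, LRMultiF.snoc]
      rw [Fin.succ_last, Fin.snoc_last, Fin.snoc_castSucc, Fin.snoc_last, funext M.last]
      exact funext h3
    · simp only [LRMultiF.cont, LRMultiF.snoc]
      rw [Fin.succ_castSucc, Fin.snoc_castSucc, Fin.snoc_castSucc, Fin.snoc_castSucc]
      exact hM k⟩, by
    simp only [LRMultiF.snoc]
    rw [Fin.snoc_castSucc, funext M.last]⟩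
  left_inv := by
    rintro ⟨⟨M, hM⟩, rfl⟩
    refine Subtype.ext (Subtype.ext (LRMultiF.ext' ?_ ?_))
    · refine funext fun k => Fin.lastCases ?_ (fun k => ?_) k
      · simp only [LRMultiF.snoc, Fin.snoc_last]; exact (funext M.last).symm
      · simp only [LRMultiF.snoc, Fin.snoc_castSucc]; rfl
    · refine funext fun k => Fin.lastCases ?_ (fun k => ?_) k
      · simp only [LRMultiF.snoc, Fin.snoc_last]
      · simp only [LRMultiF.snoc, Fin.snoc_castSucc]; rfl
  right_inv := by
    rintro ⟨⟨M, hM⟩, ⟨T, h1, h2, h3⟩⟩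
    have key : ∀ (α' : ℕ → ℕ) (M : LRMultiF (r + 1) α)
        (h : M.chain (Fin.last r).castSucc = α'),
        (h ▸ M.init : LRMultiF r α').chain = (fun j => M.chain j.castSucc) ∧
        (h ▸ M.init : LRMultiF r α').T = (fun j => M.T j.castSucc) := by
      rintro _ M rfl
      exact ⟨rfl, rfl⟩
    refine Prod.ext (Subtype.ext (LRMultiF.ext' ?_ ?_)) (Subtype.ext ?_)
    · refine (key _ _ _).1.trans ?_
      simp only [LRMultiF.snoc, Fin.snoc_castSucc]
    · refine (key _ _ _).2.trans ?_
      simp only [LRMultiF.snoc, Fin.snoc_castSucc]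
    · simp only [LRMultiF.snoc, Fin.snoc_last]

lemma lrTab_equiv {b a γ : ℕ → ℕ} (hb : Antitone b) (ha : Antitone a)
    (h0 : ∀ i, N ≤ i → a i = 0) (hγ : ∀ k, N ≤ k → γ k = 0) :
    Nonempty (LRTab b a γ ≃ {G // G ∈ {G ∈ gtSet N N b a | Good 0 G ∧ wt N G = γ}}) := by
  by_cases hba : ∀ i, b i ≤ a i
  · simp only [LRTab, hba, implies_true, true_and]
    exact lr_equiv_patterns hb ha hba h0 hγ
  · have h1 : IsEmpty (LRTab b a γ) := ⟨fun T => hba T.2.1⟩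
    have h2 : IsEmpty {G // G ∈ {G ∈ gtSet N N b a | Good 0 G ∧ wt N G = γ}} :=
      ⟨fun G => hba fun i => by
        have h := mem_gtSet.1 (mem_filter.1 G.2).1
        exact (h.first_le i 0).trans (h.le_last i 0)⟩
    exact ⟨Equiv.equivOfIsEmpty _ _⟩

lemma lrTab_finite {b a γ : ℕ → ℕ} (hb : Antitone b) (ha : Antitone a)
    (h0 : ∀ i, N ≤ i → a i = 0) (hγ : ∀ k, N ≤ k → γ k = 0) : Finite (LRTab b a γ) :=
  Finite.of_equiv _ (lrTab_equiv hb ha h0 hγ).some.symm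

lemma card_lrTab {b a γ : ℕ → ℕ} (hb : Antitone b) (ha : Antitone a)
    (h0 : ∀ i, N ≤ i → a i = 0) (hγ : ∀ k, N ≤ k → γ k = 0) :
    Nat.card (LRTab b a γ) = #{G ∈ gtSet N N b a | Good 0 G ∧ wt N G = γ} := by
  rw [Nat.card_congr (lrTab_equiv hb ha h0 hγ).some, Nat.card_eq_fintype_card, Fintype.card_coe]

instance (γ : Fin 0 → ℕ → ℕ) : Subsingleton (LRWithCont 0 γ α) := by
  refine ⟨fun M M' => Subtype.ext (LRMultiF.ext' ?_ (Subsingleton.elim _ _))⟩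
  funext k i
  obtain rfl : k = 0 := Fin.fin_one_eq_zero k
  rw [M.1.zero, M'.1.zero]

lemma LRWithCont.init_mem {γ : Fin (r + 1) → ℕ → ℕ} {ν : Fin (r + 1) → ℕ}
    (h0 : ∀ i, N ≤ i → α i = 0) (hγ : ∀ k, IsPartitionFun (ν k) (γ k))
    (M : LRWithCont (r + 1) γ α) :
    M.1.chain (Fin.last r).castSucc ∈ partFun (∑ k : Fin r, ν k.castSucc) := by
  have h1 := M.1.init.isPartitionFun (N := N) (M.1.chain_eq_zero h0 _)
  rw [mem_partFun]
  convert h1 using 2 with k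
  have h2 := M.1.isPartitionFun_cont h0 k.castSucc
  rw [M.2] at h2
  exact (hγ _).unique h2

/-- Multitableaux according to the shape of all but the last piece. -/
def lrSigmaEquiv {γ : Fin (r + 1) → ℕ → ℕ} {ν : Fin (r + 1) → ℕ} (hα : Antitone α)
    (h0 : ∀ i, N ≤ i → α i = 0) (hγ : ∀ k, IsPartitionFun (ν k) (γ k)) :
    LRWithCont (r + 1) γ α ≃ Σ α' : {f // f ∈ partFun (∑ k : Fin r, ν k.castSucc)},
      LRWithCont r (fun k => γ k.castSucc) α'.1 × LRTab α'.1 α (γ (Fin.last r)) :=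
  (Equiv.sigmaFiberEquiv fun M : LRWithCont (r + 1) γ α =>
    (⟨_, M.init_mem h0 hγ⟩ : {f // f ∈ partFun (∑ k : Fin r, ν k.castSucc)})).symm.trans
  (Equiv.sigmaCongrRight fun α' =>
    (Equiv.subtypeEquivRight fun M => by rw [Subtype.ext_iff]).trans (lrFiberEquiv hα γ α'.1))

lemma lrWithCont_finite {γ : Fin r → ℕ → ℕ} {ν : Fin r → ℕ} (hα : Antitone α)
    (h0 : ∀ i, N ≤ i → α i = 0) (hγ : ∀ k, IsPartitionFun (ν k) (γ k)) :
    Finite (LRWithCont r γ α) := by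
  induction r generalizing α N with
  | zero => infer_instance
  | succ r ih =>
    have : ∀ α' : {f // f ∈ partFun (∑ k : Fin r, ν k.castSucc)},
        Finite (LRWithCont r (fun k => γ k.castSucc) α'.1 × LRTab α'.1 α (γ (Fin.last r))) := by
      intro α'
      have h1 := mem_partFun.1 α'.2
      have := ih h1.antitone h1.2.1 fun k => hγ k.castSucc
      have := lrTab_finite (N := max N (ν (Fin.last r))) (b := α'.1) (a := α)
        (γ := γ (Fin.last r)) h1.antitone hα
        (fun i hi => h0 i ((le_max_left _ _).trans hi))
        (fun i hi => (hγ _).2.1 i ((le_max_right _ _).trans hi))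
      infer_instance
    exact Finite.of_equiv _ (lrSigmaEquiv hα h0 hγ).symm

lemma lrCard_succ {γ : Fin (r + 1) → ℕ → ℕ} {ν : Fin (r + 1) → ℕ} (hα : Antitone α)
    (h0 : ∀ i, N ≤ i → α i = 0) (hγ : ∀ k, IsPartitionFun (ν k) (γ k)) (hN : ∑ k, ν k ≤ N) :
    lrCard (r + 1) γ α = ∑ α' ∈ partFun (∑ k : Fin r, ν k.castSucc),
      lrCard r (fun k => γ k.castSucc) α' *
        #{G ∈ gtSet N N α' α | Good 0 G ∧ wt N G = γ (Fin.last r)} := by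
  rw [Fin.sum_univ_castSucc] at hN
  have hz : ∀ k, N ≤ k → γ (Fin.last r) k = 0 := fun k hk => (hγ _).2.1 k (by omega)
  have f1 : ∀ α' : {f // f ∈ partFun (∑ k : Fin r, ν k.castSucc)},
      Finite (LRWithCont r (fun k => γ k.castSucc) α'.1) := fun α' =>
    lrWithCont_finite (mem_partFun.1 α'.2).antitone (mem_partFun.1 α'.2).2.1 fun k => hγ k.castSucc
  have f2 : ∀ α' : {f // f ∈ partFun (∑ k : Fin r, ν k.castSucc)},
      Finite (LRTab α'.1 α (γ (Fin.last r))) := fun α' =>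
    lrTab_finite (mem_partFun.1 α'.2).antitone hα h0 hz
  rw [lrCard, Nat.card_congr (lrSigmaEquiv hα h0 hγ), Nat.card_sigma, univ_eq_attach]
  conv_rhs => rw [← sum_attach]
  refine sum_congr rfl fun α' _ => ?_
  rw [Nat.card_prod, card_lrTab (mem_partFun.1 α'.2).antitone hα h0 hz, lrCard]

lemma partFun_zero : partFun 0 = {0} := by
  ext f
  rw [mem_partFun, mem_singleton]
  constructor
  · intro h; exact funext fun i => h.2.1 i (Nat.zero_le _)
  · rintro rfl; exact ⟨fun _ _ _ => le_rfl, fun _ _ => rfl, rfl⟩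

lemma lrCard_zero (γ : Fin 0 → ℕ → ℕ) : lrCard 0 γ 0 = 1 := by
  rw [lrCard, Nat.card_eq_one_iff_unique]
  exact ⟨inferInstance, ⟨⟨⟨fun _ => 0, fun _ _ _ _ => le_rfl, fun _ => rfl, fun _ => rfl,
    fun k => k.elim0, fun k => k.elim0, fun k => k.elim0⟩, fun k => k.elim0⟩⟩⟩

/-- The Littlewood–Richardson rule for a product of several Schur polynomials. -/
lemma prod_schur {q : ℕ} (γ : Fin r → ℕ → ℕ) (ν : Fin r → ℕ)
    (hγ : ∀ k, IsPartitionFun (ν k) (γ k)) (hq : q ≤ N) (hN : ∑ k, ν k ≤ N) :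
    ∏ k, schur N q 0 (γ k) = ∑ f ∈ partFun (∑ k, ν k), lrCard r γ f • schur N q 0 f := by
  induction r with
  | zero => simp [partFun_zero, lrCard_zero, schur_zero]
  | succ r ih =>
    have hN' := hN
    rw [Fin.sum_univ_castSucc] at hN'
    rw [Fin.prod_univ_castSucc, ih (fun k => γ k.castSucc) (fun k => ν k.castSucc)
      (fun k => hγ k.castSucc) (by omega), sum_mul]
    rw [sum_congr rfl fun f hf => by
      rw [smul_mul_assoc, schur_mul_partition hq hN' (mem_partFun.1 hf) (hγ _), smul_sum]]
    rw [sum_comm, ← Fin.sum_univ_castSucc]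
    refine sum_congr rfl fun f hf => ?_
    have hf' := mem_partFun.1 hf
    rw [lrCard_succ hf'.antitone (fun i hi => hf'.2.1 i (by omega)) hγ hN, sum_smul]
    exact sum_congr rfl fun g _ => smul_smul _ _ _

end

section
variable {r N : ℕ} {α β : ℕ → ℕ}

/-- Pairs of multitableaux with equal contents, with the content fixed. -/
noncomputable def lrPairsFiberEquiv {ν : Fin r → ℕ}
    (hα : ∀ i, N ≤ i → α i = 0) (hβ : ∀ i, N ≤ i → β i = 0)
    (γ : Fin r → ℕ → ℕ) (hγ : ∀ k, IsPartitionFun (ν k) (γ k)) :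
    {TS : LRPairs r α β ν // TS.1.1.cont = γ} ≃ LRWithCont r γ α × LRWithCont r γ β where
  toFun := fun ⟨⟨(M, M'), h⟩, h'⟩ =>
    (⟨M, congrFun h'⟩, ⟨M', fun k => (h.2.2 k).symm.trans (congrFun h' k)⟩)
  invFun := fun ⟨⟨M, h⟩, ⟨M', h'⟩⟩ => ⟨⟨(M, M'),
    fun k => by
      have := M.isPartitionFun_cont hα k
      rw [h] at this
      exact this.unique (hγ k),
    fun k => by
      have := M'.isPartitionFun_cont hβ k
      rw [h'] at this
      exact this.unique (hγ k),
    fun k => (h k).trans (h' k).symm⟩, funext h⟩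
  left_inv _ := rfl
  right_inv _ := rfl

/-- Pairs of multitableaux with equal contents, according to the content. -/
noncomputable def lrPairsEquiv (ν : Fin r → ℕ)
    (hα : ∀ i, N ≤ i → α i = 0) (hβ : ∀ i, N ≤ i → β i = 0) :
    LRPairs r α β ν ≃ Σ γ : {γ // γ ∈ Fintype.piFinset fun k => partFun (ν k)},
      LRWithCont r γ.1 α × LRWithCont r γ.1 β :=
  (Equiv.sigmaFiberEquiv fun TS : LRPairs r α β ν =>
    (⟨TS.1.1.cont, Fintype.mem_piFinset.2 fun k => mem_partFun.2 (by
      have := TS.1.1.isPartitionFun_cont hα k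
      rwa [TS.2.1 k] at this)⟩ : {γ // γ ∈ Fintype.piFinset fun k => partFun (ν k)})).symm.trans
  (Equiv.sigmaCongrRight fun γ =>
    (Equiv.subtypeEquivRight fun M => by rw [Subtype.ext_iff]).trans
      (lrPairsFiberEquiv hα hβ γ.1 fun k => mem_partFun.1 (Fintype.mem_piFinset.1 γ.2 k)))

lemma lrPairs_finite_and_card {n : ℕ} (ν : Fin r → ℕ) (hα : IsPartitionFun n α)
    (hβ : IsPartitionFun n β) : Finite (LRPairs r α β ν) ∧ Nat.card (LRPairs r α β ν) =
      ∑ γ ∈ Fintype.piFinset fun k => partFun (ν k), lrCard r γ α * lrCard r γ β := by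
  have f1 : ∀ γ : {γ // γ ∈ Fintype.piFinset fun k => partFun (ν k)},
      Finite (LRWithCont r γ.1 α) := fun γ => lrWithCont_finite hα.antitone hα.2.1
        fun k => mem_partFun.1 (Fintype.mem_piFinset.1 γ.2 k)
  have f2 : ∀ γ : {γ // γ ∈ Fintype.piFinset fun k => partFun (ν k)},
      Finite (LRWithCont r γ.1 β) := fun γ => lrWithCont_finite hβ.antitone hβ.2.1
        fun k => mem_partFun.1 (Fintype.mem_piFinset.1 γ.2 k)
  refine ⟨Finite.of_equiv _ (lrPairsEquiv ν hα.2.1 hβ.2.1).symm, ?_⟩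
  rw [Nat.card_congr (lrPairsEquiv ν hα.2.1 hβ.2.1), Nat.card_sigma, univ_eq_attach]
  conv_rhs => rw [← sum_attach]
  exact sum_congr rfl fun γ _ => by rw [Nat.card_prod, lrCard, lrCard]

end

section

lemma sum_range_getD (L : List ℕ) : ∑ i ∈ range L.length, L.getD i 0 = L.sum := by
  induction L with
  | nil => simp
  | cons x L ih => rw [List.length_cons, sum_range_succ', List.sum_cons, ← ih]; simp [add_comm]

lemma pf_spec {n : ℕ} (P : n.Partition) : ∃ L : List ℕ, (L : Multiset ℕ) = P.parts ∧
    L.Pairwise (· ≥ ·) ∧ pf P = fun i => L.getD i 0 := by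
  refine ⟨(P.parts.sort (· ≤ ·)).reverse, ?_, ?_, rfl⟩
  · rw [Multiset.coe_reverse, Multiset.sort_eq]
  · rw [List.pairwise_reverse]
    exact Multiset.pairwise_sort _ _

lemma isPartitionFun_pf {n : ℕ} (P : n.Partition) : IsPartitionFun n (pf P) := by
  obtain ⟨L, h1, h2, h3⟩ := pf_spec P
  have h4 : Antitone (pf P) := by
    intro i j hij
    rw [h3]
    by_cases hj : j < L.length
    · simp only [List.getD_eq_getElem _ _ hj, List.getD_eq_getElem _ _ (hij.trans_lt hj)]
      rcases hij.eq_or_lt with rfl | hlt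
      · exact le_rfl
      · exact List.pairwise_iff_getElem.1 h2 i j _ _ hlt
    · exact (List.getD_eq_default _ _ (not_lt.1 hj)).trans_le (Nat.zero_le _)
  have h5 := isPartitionFun_of_antitone h4 (K := L.length) fun k hk => by
    rw [h3]; exact List.getD_eq_default _ _ hk
  have h6 : ∑ k ∈ range L.length, pf P k = n := by
    rw [h3, sum_range_getD L, ← P.parts_sum, ← h1, Multiset.sum_coe]
  rwa [h6] at h5

lemma pf_injective {n : ℕ} : Function.Injective (pf : n.Partition → ℕ → ℕ) := by
  intro P Q h
  obtain ⟨L, h1, -, h3⟩ := pf_spec P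
  obtain ⟨L', h1', -, h3'⟩ := pf_spec Q
  rw [h3, h3'] at h
  have key : ∀ (R : n.Partition) (L : List ℕ), (L : Multiset ℕ) = R.parts →
      ∀ i, i < L.length ↔ L.getD i 0 ≠ 0 := by
    intro R L hL i
    constructor
    · intro hi
      rw [List.getD_eq_getElem _ _ hi]
      refine (R.parts_pos (i := L[i]) ?_).ne'
      rw [← hL, Multiset.mem_coe]
      exact List.getElem_mem hi
    · intro hi
      by_contra! hle
      exact hi (List.getD_eq_default _ _ hle)
  have hlen : ∀ i, i < L.length ↔ i < L'.length := fun i => by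
    rw [key P L h1, key Q L' h1', congrFun h i]
  have e : L = L' := by
    refine List.ext_getElem ?_ fun i hi hi' => ?_
    · have a1 := hlen L.length
      have a2 := hlen L'.length
      omega
    · rw [← List.getD_eq_getElem _ 0 hi, ← List.getD_eq_getElem _ 0 hi', congrFun h i]
  exact Nat.Partition.ext (by rw [← h1, ← h1', e])

lemma exists_pf_eq {n : ℕ} {f : ℕ → ℕ} (h : IsPartitionFun n f) : ∃ P : n.Partition, pf P = f := by
  have hex : ∃ t, f t = 0 := ⟨n, h.2.1 n le_rfl⟩
  set t := Nat.find hex with ht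
  have h0 : ∀ i, t ≤ i → f i = 0 := fun i hi => by
    have h1 := h.antitone hi
    have h2 : f t = 0 := Nat.find_spec hex
    omega
  have hsum : ((List.range t).map f).sum = n := by
    have e : ((List.range t).map f).sum = ∑ i ∈ range t, f i := rfl
    rw [e]
    exact (isPartitionFun_of_antitone h.antitone h0).unique h
  have hpos : ∀ {i}, i ∈ (((List.range t).map f : List ℕ) : Multiset ℕ) → 0 < i := by
    intro i hi
    rw [Multiset.mem_coe, List.mem_map] at hi
    obtain ⟨j, hj, rfl⟩ := hi
    exact Nat.pos_of_ne_zero (Nat.find_min hex (List.mem_range.1 hj))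
  refine ⟨⟨((List.range t).map f : List ℕ), hpos, by rw [Multiset.sum_coe, hsum]⟩, ?_⟩
  obtain ⟨L, h1, h2, h3⟩ := pf_spec ⟨((List.range t).map f : List ℕ), hpos, by
    rw [Multiset.sum_coe, hsum]⟩
  have hL : L = (List.range t).map f := by
    refine List.Perm.eq_of_pairwise (le := (· ≥ ·)) (fun a b _ _ h1 h2 => le_antisymm h2 h1) h2 ?_
      (Multiset.coe_eq_coe.1 h1)
    rw [List.pairwise_map]
    exact List.pairwise_lt_range.imp fun hab => h.antitone hab.le
  rw [h3, hL]
  funext i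
  by_cases hi : i < t
  · rw [List.getD_eq_getElem _ _ (by simpa using hi)]
    simp
  · rw [List.getD_eq_default _ _ (by simpa using hi), h0 i (not_lt.1 hi)]

lemma sum_pf {n : ℕ} (F : (ℕ → ℕ) → ℕ) :
    ∑ P : n.Partition, F (pf P) = ∑ f ∈ partFun n, F f := by
  refine sum_nbij pf (fun P _ => mem_partFun.2 (isPartitionFun_pf P)) pf_injective.injOn ?_
    fun _ _ => rfl
  intro f hf
  obtain ⟨P, rfl⟩ := exists_pf_eq (mem_partFun.1 hf)
  exact ⟨P, mem_coe.2 (mem_univ P), rfl⟩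

end

section
variable {p q : ℕ}

/-- The number of semistandard tableaux of shape `f` and content `s`, as patterns. -/
noncomputable def kostkaGT (N : ℕ) (f : ℕ → ℕ) (s : Fin p → ℕ) : ℕ :=
  #{G ∈ gtSet N p 0 f | wt N G = extc s}

/-- The monomial with exponents `s`. -/
noncomputable def xpow {σ : Type*} [Fintype σ] (s : σ → ℕ) : MvPolynomial σ ℤ :=
  ∏ i, MvPolynomial.X i ^ s i

lemma coeff_xpow {σ : Type*} [Fintype σ] (s t : σ → ℕ) :
    MvPolynomial.coeff (Finsupp.equivFunOnFinite.symm t) (xpow s) = if s = t then 1 else 0 := by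
  have : xpow s = MvPolynomial.monomial (Finsupp.equivFunOnFinite.symm s) 1 := by
    rw [MvPolynomial.monomial_eq, Finsupp.prod_fintype _ _ fun _ => pow_zero _]
    simp [xpow]
  rw [this, MvPolynomial.coeff_monomial]
  simp only [EmbeddingLike.apply_eq_iff_eq]

lemma xpow_sumElim (s : Fin p → ℕ) (t : Fin q → ℕ) : xpow (Sum.elim s t) =
    MvPolynomial.rename Sum.inl (xpow s) * MvPolynomial.rename Sum.inr (xpow t) := by
  simp [xpow, Fintype.prod_sum_type]

lemma IsGT.wt_eq_extc_iff {P : ℕ} {b a : ℕ → ℕ} {G : ℕ → ℕ → ℕ} (h : IsGT P p b a G)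
    (s : Fin p → ℕ) : wt P G = extc s ↔ (fun i : Fin p => wt P G i) = s := by
  constructor
  · intro e
    funext i
    rw [e, extc_val]
  · rintro rfl
    funext k
    by_cases hk : k < p
    · rw [extc_of_lt _ hk]
    · rw [extc_of_le _ (not_lt.1 hk), h.wt_eq_zero (not_lt.1 hk)]

lemma schur_eq_sum_kostkaGT {N m : ℕ} {f : ℕ → ℕ} (hf : IsPartitionFun m f) (hm : m ≤ N) :
    schur N p 0 f = ∑ s ∈ piAntidiag (univ : Finset (Fin p)) m, kostkaGT N f s • xpow s := by
  have hmem : ∀ G ∈ gtSet N p 0 f, (fun i : Fin p => wt N G i) ∈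
      piAntidiag (univ : Finset (Fin p)) m := by
    intro G hG
    have := (mem_gtSet.1 hG).sum_wt
    rw [hf.sum_range hm] at this
    simpa [mem_piAntidiag, Fin.sum_univ_eq_sum_range] using this
  rw [schur, ← sum_fiberwise_of_maps_to hmem]
  refine sum_congr rfl fun s _ => ?_
  rw [sum_congr rfl (g := fun _ => xpow s) (fun G hG => by rw [← (mem_filter.1 hG).2, xpow]),
    sum_const, kostkaGT]
  congr 2
  ext G
  simp only [mem_filter, mem_gtSet, and_congr_right_iff]
  exact fun hG => (hG.wt_eq_extc_iff s).symm

lemma coeff_schur_mul_schur {N : ℕ} (f g : ℕ → ℕ) (l : Fin p → ℕ) (m : Fin q → ℕ) :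
    MvPolynomial.coeff (Finsupp.equivFunOnFinite.symm (Sum.elim l m))
      (MvPolynomial.rename Sum.inl (schur N p 0 f) *
        MvPolynomial.rename Sum.inr (schur N q 0 g)) = (kostkaGT N f l * kostkaGT N g m : ℤ) := by
  have e1 : ∀ (p : ℕ) (f : ℕ → ℕ), schur N p 0 f =
      ∑ G ∈ gtSet N p 0 f, xpow fun i : Fin p => wt N G i := fun _ _ => rfl
  have e2 : ∀ (p : ℕ) (f : ℕ → ℕ) (s : Fin p → ℕ), (kostkaGT N f s : ℤ) =
      ∑ G ∈ gtSet N p 0 f, if (fun i : Fin p => wt N G i) = s then 1 else 0 := by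
    intro p f s
    rw [kostkaGT, card_filter, Nat.cast_sum]
    refine sum_congr rfl fun G hG => ?_
    simp only [(mem_gtSet.1 hG).wt_eq_extc_iff, Nat.cast_ite, Nat.cast_one, Nat.cast_zero]
  rw [e1, e1, e2, e2, map_sum, map_sum, sum_mul_sum, sum_mul_sum, MvPolynomial.coeff_sum]
  refine sum_congr rfl fun G _ => ?_
  rw [MvPolynomial.coeff_sum]
  refine sum_congr rfl fun G' _ => ?_
  rw [← xpow_sumElim, coeff_xpow]
  simp only [Sum.elim_eq_iff, ite_and, mul_ite, mul_one, mul_zero]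
  split_ifs <;> rfl

/-- The matrices with sum of entries `m`. -/
noncomputable def matSet (p q m : ℕ) : Finset (Fin p → Fin q → ℕ) :=
  (piAntidiag (univ : Finset (Fin p)) m).biUnion fun s =>
    Fintype.piFinset fun i => piAntidiag (univ : Finset (Fin q)) (s i)

lemma mem_matSet {m : ℕ} {B : Fin p → Fin q → ℕ} : B ∈ matSet p q m ↔ ∑ i, ∑ j, B i j = m := by
  simp only [matSet, mem_biUnion, mem_piAntidiag, Fintype.mem_piFinset, mem_univ, implies_true,
    and_true]
  constructor
  · rintro ⟨s, rfl, hB⟩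
    exact sum_congr rfl fun i _ => hB i
  · intro h
    exact ⟨fun i => ∑ j, B i j, h, fun _ => rfl⟩

/-- Cauchy's identity in a fixed degree. -/
lemma cauchy {N m : ℕ} (hq : q ≤ N) (hm : m ≤ N) :
    ∑ B ∈ matSet p q m, xpow (Sum.elim (fun i => ∑ j, B i j) fun j => ∑ i, B i j) =
      ∑ f ∈ partFun m, MvPolynomial.rename Sum.inl (schur N p 0 f) *
        MvPolynomial.rename Sum.inr (schur N q 0 f) := by
  have hrow : ∀ (s : Fin p → ℕ) (B : Fin p → Fin q → ℕ),
      B ∈ (Fintype.piFinset fun i => piAntidiag (univ : Finset (Fin q)) (s i)) →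
        (fun i => ∑ j, B i j) = s := by
    intro s B hB
    simp only [Fintype.mem_piFinset, mem_piAntidiag] at hB
    exact funext fun i => (hB i).1
  rw [matSet, sum_biUnion]
  · have : ∀ s ∈ piAntidiag (univ : Finset (Fin p)) m,
        ∑ B ∈ (Fintype.piFinset fun i => piAntidiag (univ : Finset (Fin q)) (s i)),
          xpow (Sum.elim (fun i => ∑ j, B i j) fun j => ∑ i, B i j) =
        ∑ f ∈ partFun m, MvPolynomial.rename Sum.inl (kostkaGT N f s • xpow s) *
          MvPolynomial.rename Sum.inr (schur N q 0 f) := by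
      intro s hs
      have hs' : ∑ i, s i = m := (mem_piAntidiag.1 hs).1
      have := congrArg (MvPolynomial.rename (Sum.inr : Fin q → Fin p ⊕ Fin q))
        (cauchy_rows (q := q) s hs' hq hm)
      rw [map_sum, map_sum] at this
      rw [sum_congr rfl fun B hB => by rw [xpow_sumElim, hrow s B hB], ← mul_sum]
      have e : ∀ B : Fin p → Fin q → ℕ, xpow (fun k => ∑ i, B i k) =
        ∏ k : Fin q, MvPolynomial.X (R := ℤ) k ^ ∑ i, B i k := fun _ => rfl
      simp only [e, this, mul_sum]
      refine sum_congr rfl fun f _ => ?_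
      rw [map_nsmul, map_nsmul, mul_smul_comm, smul_mul_assoc, kostkaGT]
    rw [sum_congr rfl this, sum_comm]
    refine sum_congr rfl fun f hf => ?_
    rw [schur_eq_sum_kostkaGT (p := p) (mem_partFun.1 hf) hm, map_sum, sum_mul]
  · intro s _ t _ hst
    refine disjoint_left.2 fun B h1 h2 => hst ?_
    rw [← hrow s B h1, hrow t B h2]

lemma xpow_sum {σ ι : Type*} [Fintype σ] [Fintype ι] (s : ι → σ → ℕ) :
    ∏ k, xpow (s k) = xpow fun x => ∑ k, s k x := by
  simp only [xpow]
  rw [prod_comm]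
  exact prod_congr rfl fun x _ => prod_pow_eq_pow_sum _ _ _

/-- The three-dimensional matrices with marginals `l`, `m`, `ν`. -/
noncomputable def boxSet {r : ℕ} (l : Fin p → ℕ) (m : Fin q → ℕ) (ν : Fin r → ℕ) :
    Finset (Fin r → Fin p → Fin q → ℕ) :=
  {A ∈ Fintype.piFinset fun k => matSet p q (ν k) |
    (∀ i, ∑ k, ∑ j, A k i j = l i) ∧ ∀ j, ∑ k, ∑ i, A k i j = m j}

lemma card_boxSet {r n N : ℕ} (l : Fin p → ℕ) (m : Fin q → ℕ) (ν : Fin r → ℕ)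
    (hν : ∑ k, ν k = n) (hn : n ≤ N) (hp : p ≤ N) (hq : q ≤ N) :
    #(boxSet l m ν) = ∑ f ∈ partFun n, ∑ g ∈ partFun n, kostkaGT N f l * (kostkaGT N g m *
      ∑ γ ∈ Fintype.piFinset fun k => partFun (ν k), lrCard r γ f * lrCard r γ g) := by
  have hνN : ∀ k, ν k ≤ N := fun k =>
    (single_le_sum (f := ν) (fun _ _ => Nat.zero_le _) (mem_univ k)).trans (by omega)
  have h1 : ∑ A ∈ Fintype.piFinset fun k => matSet p q (ν k),
      xpow (Sum.elim (fun i => ∑ k, ∑ j, A k i j) fun j => ∑ k, ∑ i, A k i j) =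
      ∑ γ ∈ Fintype.piFinset fun k => partFun (ν k), ∑ f ∈ partFun n, ∑ g ∈ partFun n,
        (lrCard r γ f * lrCard r γ g) • (MvPolynomial.rename Sum.inl (schur N p 0 f) *
          MvPolynomial.rename Sum.inr (schur N q 0 g)) := by
    have h2 := prod_congr rfl fun k (_ : k ∈ (univ : Finset (Fin r))) =>
      cauchy (p := p) (q := q) (m := ν k) hq (hνN k)
    rw [prod_univ_sum, prod_univ_sum] at h2
    refine Eq.trans ?_ (h2.trans ?_)
    · refine sum_congr rfl fun A _ => ?_
      rw [xpow_sum]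
      congr 1
      funext x
      cases x <;> rfl
    · refine sum_congr rfl fun γ hγ => ?_
      have hγ' := fun k => mem_partFun.1 (Fintype.mem_piFinset.1 hγ k)
      rw [prod_mul_distrib, ← map_prod, ← map_prod, prod_schur γ ν hγ' hp (by omega),
        prod_schur γ ν hγ' hq (by omega), hν, map_sum, map_sum, sum_mul_sum]
      refine sum_congr rfl fun f _ => sum_congr rfl fun g _ => ?_
      rw [map_nsmul, map_nsmul, smul_mul_smul_comm]
  have h3 := congrArg (MvPolynomial.coeffAddMonoidHom
    (Finsupp.equivFunOnFinite.symm (Sum.elim l m))) h1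
  simp only [map_sum, map_nsmul, MvPolynomial.coeffAddMonoidHom_apply, coeff_xpow,
    coeff_schur_mul_schur] at h3
  rw [sum_boole] at h3
  have h4 : (#(boxSet l m ν) : ℤ) = ∑ γ ∈ Fintype.piFinset fun k => partFun (ν k),
      ∑ f ∈ partFun n, ∑ g ∈ partFun n,
        (lrCard r γ f * lrCard r γ g) • ((kostkaGT N f l : ℤ) * kostkaGT N g m) := by
    rw [← h3]
    congr 2
    ext A
    simp [boxSet, funext_iff]
  rw [sum_comm] at h4
  zify
  rw [h4]
  refine sum_congr rfl fun f _ => ?_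
  rw [sum_comm]
  refine sum_congr rfl fun g _ => ?_
  simp only [mul_sum]
  refine sum_congr rfl fun γ _ => ?_
  rw [nsmul_eq_mul]
  push_cast
  ring

/-- Three-dimensional matrices, with the last index moved to the front. -/
def boxEquiv {r : ℕ} (l : Fin p → ℕ) (m : Fin q → ℕ) (ν : Fin r → ℕ) :
    {A : Fin p → Fin q → Fin r → ℕ //
      (∀ i, ∑ j, ∑ k, A i j k = l i) ∧ (∀ j, ∑ i, ∑ k, A i j k = m j) ∧
      (∀ k, ∑ i, ∑ j, A i j k = ν k)} ≃ {A // A ∈ boxSet l m ν} where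
  toFun A := ⟨fun k i j => A.1 i j k, by
    simp only [boxSet, mem_filter, Fintype.mem_piFinset, mem_matSet]
    refine ⟨A.2.2.2, fun i => ?_, fun j => ?_⟩
    · rw [sum_comm, A.2.1]
    · rw [sum_comm, A.2.2.1]⟩
  invFun A := ⟨fun i j k => A.1 k i j, by
    have h := A.2
    simp only [boxSet, mem_filter, Fintype.mem_piFinset, mem_matSet] at h
    refine ⟨fun i => ?_, fun j => ?_, h.1⟩
    · rw [sum_comm, h.2.1]
    · rw [sum_comm, h.2.2]⟩
  left_inv _ := rfl
  right_inv _ := rfl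

lemma ssyt_finite_and_card {n N : ℕ} {f : ℕ → ℕ} (hf : IsPartitionFun n f) (hn : n ≤ N)
    (s : Fin p → ℕ) :
    Finite {T // IsSSYT f T ∧ ∀ k, skewContent f (fun _ => 0) T k = extc s k} ∧
      Nat.card {T // IsSSYT f T ∧ ∀ k, skewContent f (fun _ => 0) T k = extc s k} =
        kostkaGT N f s := by
  have e := (ssyt_equiv_patterns (P := N) (N := p) hf.antitone
    (fun i hi => hf.2.1 i (hn.trans hi)) (γ := extc s) fun k hk => extc_of_le s hk).some
  refine ⟨Finite.of_equiv _ e.symm, ?_⟩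
  rw [Nat.card_congr e, Nat.card_eq_fintype_card, Fintype.card_coe, kostkaGT]

lemma dominates_of_kostkaGT_ne_zero {N : ℕ} {f : ℕ → ℕ} {s : Fin p → ℕ}
    (h : kostkaGT N f s ≠ 0) : Dominates f (extc s) := by
  obtain ⟨G, hG⟩ := card_ne_zero.1 h
  rw [mem_filter, mem_gtSet] at hG
  rw [← hG.2]
  exact hG.1.dominates

end

/-- bijection between `M(l,m,ν)` and
`⨿_{α ⊵ l, β ⊵ m} SSYT(α,l) × SSYT(β,m) × LR(α,β;ν)`. -/
theorem stmt16 (n p q r : ℕ) (l : Fin p → ℕ) (m : Fin q → ℕ) (ν : Fin r → ℕ)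
    (hl : ∑ i, l i = n) (hm : ∑ j, m j = n) (hν : ∑ k, ν k = n) :
    Nonempty
      ({A : Fin p → Fin q → Fin r → ℕ //
          (∀ i, ∑ j, ∑ k, A i j k = l i) ∧ (∀ j, ∑ i, ∑ k, A i j k = m j) ∧
          (∀ k, ∑ i, ∑ j, A i j k = ν k)} ≃
        Σ ab : {ab : n.Partition × n.Partition //
            Dominates (pf ab.1) (extc l) ∧ Dominates (pf ab.2) (extc m)},
          {T : ℕ → ℕ → ℕ //
              IsSSYT (pf ab.1.1) T ∧
              ∀ k, skewContent (pf ab.1.1) (fun _ => 0) T k = extc l k} ×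
          {T : ℕ → ℕ → ℕ //
              IsSSYT (pf ab.1.2) T ∧
              ∀ k, skewContent (pf ab.1.2) (fun _ => 0) T k = extc m k} ×
          LRPairs r (pf ab.1.1) (pf ab.1.2) ν) := by
  have hn : n ≤ n + p + q := by omega
  have f1 := fun P : n.Partition => ssyt_finite_and_card (isPartitionFun_pf P) hn l
  have f2 := fun P : n.Partition => ssyt_finite_and_card (isPartitionFun_pf P) hn m
  have f3 := fun P Q : n.Partition =>
    lrPairs_finite_and_card ν (isPartitionFun_pf P) (isPartitionFun_pf Q)
  have i1 := fun P => (f1 P).1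
  have i2 := fun P => (f2 P).1
  have i3 := fun P Q => (f3 P Q).1
  have := Finite.of_equiv _ (boxEquiv l m ν).symm
  refine Finite.card_eq.1 ?_
  rw [Nat.card_congr (boxEquiv l m ν), Nat.card_eq_fintype_card, Fintype.card_coe,
    card_boxSet l m ν hν hn (by omega) (by omega), Nat.card_sigma]
  simp only [Nat.card_prod, (f1 _).2, (f2 _).2, (f3 _ _).2]
  rw [← sum_subtype {ab : n.Partition × n.Partition | Dominates (pf ab.1) (extc l) ∧
    Dominates (pf ab.2) (extc m)} (fun _ => by simp) (fun ab => kostkaGT (n + p + q) (pf ab.1) l *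
      (kostkaGT (n + p + q) (pf ab.2) m * ∑ γ ∈ Fintype.piFinset fun k => partFun (ν k),
        lrCard r γ (pf ab.1) * lrCard r γ (pf ab.2))), sum_filter_of_ne, Fintype.sum_prod_type]
  · simp only [← sum_pf]
  · intro ab _ hne
    exact ⟨dominates_of_kostkaGT_ne_zero (left_ne_zero_of_mul hne),
      dominates_of_kostkaGT_ne_zero (left_ne_zero_of_mul (right_ne_zero_of_mul hne))⟩
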